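/- arXiv:2510.18367 — 4 statements merged into one kernel-verified Lean document; each statement's English description precedes it below -/
import Mathlib

section
/- Let p_1, p_2 be Borel probability measures on the circle S¹ with circular cumulative distribution functions P_1, P_2. Then W_1(p_1, p_2) = min_{α ∈ ℝ} ∫_0^{2π} |P_1(x) − P_2(x) − α| dx. -/
open MeasureTheory Real Filter
open scoped ENNReal

/-- The circle `S¹` is identified with `[0, 2π)` endowed with the metric
`d(x,y) = min(|x−y|, 2π−|x−y|)`. -/
noncomputable def circleDist (x y : ℝ) : ℝ := min |x - y| (2 * π - |x - y|)

/-- A Borel probability measure on the circle, identified with a Borel probability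
measure on `ℝ` giving full mass to `[0, 2π)`. -/
def IsCircleProb (μ : Measure ℝ) : Prop :=
  IsProbabilityMeasure μ ∧ μ (Set.Ico 0 (2 * π)) = 1

/-- The `L^p` Wasserstein distance on the circle. -/
noncomputable def circleW (p : ℝ) (μ ν : Measure ℝ) : ℝ≥0∞ :=
  ⨅ γ ∈ {γ : Measure (ℝ × ℝ) | IsProbabilityMeasure γ ∧ γ.map Prod.fst = μ ∧ γ.map Prod.snd = ν},
    (∫⁻ z, ENNReal.ofReal (circleDist z.1 z.2) ^ p ∂γ) ^ (1 / p)

/-- The circular cumulative distribution function of a probability measure on the circle: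
`Q(x) = q([0, x])` for `0 ≤ x < 2π`, extended to `ℝ` by `Q(x ± 2π) = Q(x) ± 1`. -/
noncomputable def circleCDF (q : Measure ℝ) (x : ℝ) : ℝ :=
  (⌊x / (2 * π)⌋ : ℝ) + (q (Set.Icc 0 (2 * π * Int.fract (x / (2 * π))))).toReal

open ProbabilityTheory Set

theorem IsCircleProb.cdf_eq_zero {p : Measure ℝ} (h : IsCircleProb p) {t : ℝ} (ht : t < 0) :
    cdf p t = 0 := by
  have := h.1
  rw [cdf_eq_real, measureReal_def, measure_mono_null (t := (Ico 0 (2 * π))ᶜ), ENNReal.toReal_zero]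
  · intro x hx hx'
    exact absurd (hx.trans_lt ht) (not_lt.2 hx'.1)
  · rw [prob_compl_eq_zero_iff measurableSet_Ico]
    exact h.2

theorem IsCircleProb.cdf_eq_one {p : Measure ℝ} (h : IsCircleProb p) {t : ℝ} (ht : 2 * π ≤ t) :
    cdf p t = 1 := by
  have := h.1
  rw [cdf_eq_real, measureReal_def]
  suffices p (Iic t) = 1 by simp [this]
  refine le_antisymm prob_le_one (h.2 ▸ measure_mono fun x hx => ?_)
  exact hx.2.le.trans ht

theorem IsCircleProb.ae_mem_Ico {p : Measure ℝ} (h : IsCircleProb p) :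
    ∀ᵐ x ∂p, x ∈ Ico 0 (2 * π) := by
  have := h.1
  rw [ae_iff]
  exact (prob_compl_eq_zero_iff measurableSet_Ico).2 h.2

theorem IsCircleProb.toReal_Icc_eq_cdf {p : Measure ℝ} (h : IsCircleProb p) (t : ℝ) :
    (p (Icc 0 t)).toReal = cdf p t := by
  have := h.1
  rw [cdf_eq_real, measureReal_def]
  congr 1
  refine measure_congr ?_
  filter_upwards [h.ae_mem_Ico] with x hx
  exact propext ⟨fun hx' => hx'.2, fun hx' => ⟨hx.1, hx'⟩⟩

theorem IsCircleProb.circleCDF_eq {p : Measure ℝ} (h : IsCircleProb p) (t : ℝ) :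
    circleCDF p t = ⌊t / (2 * π)⌋ + cdf p (t - ⌊t / (2 * π)⌋ * (2 * π)) := by
  rw [circleCDF, h.toReal_Icc_eq_cdf, Int.fract]
  congr 2
  field_simp

theorem IsCircleProb.circleCDF_eq_cdf {p : Measure ℝ} (h : IsCircleProb p) {t : ℝ}
    (ht : t ∈ Ico 0 (2 * π)) : circleCDF p t = cdf p t := by
  have : ⌊t / (2 * π)⌋ = 0 := by
    rw [Int.floor_eq_zero_iff]
    exact ⟨div_nonneg ht.1 two_pi_pos.le, (div_lt_one two_pi_pos).2 ht.2⟩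
  simp [h.circleCDF_eq, this]

theorem IsCircleProb.measurable_circleCDF {p : Measure ℝ} (h : IsCircleProb p) :
    Measurable (circleCDF p) := by
  have h1 : Measurable fun t : ℝ => (⌊t / (2 * π)⌋ : ℝ) :=
    (measurable_from_top (f := fun n : ℤ => (n : ℝ))).comp
      (Int.measurable_floor.comp (measurable_id.div_const _))
  rw [funext h.circleCDF_eq]
  exact h1.add ((monotone_cdf p).measurable.comp (measurable_id.sub (h1.mul_const _)))

theorem circleCDF_add_zsmul (p : Measure ℝ) (n : ℤ) (t : ℝ) :
    circleCDF p (t + n * (2 * π)) = circleCDF p t + n := by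
  have h : (t + n * (2 * π)) / (2 * π) = t / (2 * π) + n := by
    have := two_pi_pos.ne'
    field_simp
  simp only [circleCDF, h, Int.floor_add_intCast, Int.fract_add_intCast]
  push_cast
  ring

/-- Every probability measure on the real line has a measurable quantile function. -/
theorem exists_measurable_quantile (μ : Measure ℝ) :
    ∃ q : ℝ → ℝ, Measurable q ∧ ∀ v ∈ Ioo (0:ℝ) 1, ∀ t, q v ≤ t ↔ v ≤ cdf μ t := by
  classical
  let q : ℝ → ℝ := fun v => if v ∈ Ioo (0:ℝ) 1 then sInf {t | v ≤ cdf μ t} else 0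
  have hq : ∀ v ∈ Ioo (0:ℝ) 1, ∀ t, q v ≤ t ↔ v ≤ cdf μ t := by
    intro v hv t
    have hne : {t | v ≤ cdf μ t}.Nonempty :=
      (((tendsto_cdf_atTop μ).eventually (lt_mem_nhds hv.2)).exists).imp fun _ h => le_of_lt h
    obtain ⟨b, hb⟩ := ((tendsto_cdf_atBot μ).eventually (gt_mem_nhds hv.1)).exists
    have hbdd : BddBelow {t | v ≤ cdf μ t} :=
      ⟨b, fun x hx => le_of_not_gt fun hxb =>
        (hb.trans_le hx).not_ge (monotone_cdf μ hxb.le)⟩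
    simp only [q, if_pos hv]
    refine ⟨fun h => ?_, fun h => csInf_le hbdd h⟩
    have hlim : Tendsto (cdf μ) (nhdsWithin t (Ioi t)) (nhds (cdf μ t)) :=
      ((cdf μ).right_continuous t).mono_left (nhdsWithin_mono _ Ioi_subset_Ici_self)
    refine ge_of_tendsto hlim ?_
    filter_upwards [self_mem_nhdsWithin] with s hs
    obtain ⟨r, hr, hrs⟩ := exists_lt_of_csInf_lt hne (lt_of_le_of_lt h hs)
    exact le_trans hr (monotone_cdf μ hrs.le)
  refine ⟨q, measurable_of_Iic fun t => ?_, hq⟩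
  have : q ⁻¹' Iic t = (Ioo (0:ℝ) 1 ∩ Iic (cdf μ t)) ∪ ((Ioo (0:ℝ) 1)ᶜ ∩ {_v | 0 ≤ t}) := by
    ext v
    by_cases hv : v ∈ Ioo (0:ℝ) 1
    · have := hq v hv t
      simp only [mem_preimage, mem_Iic, mem_union, mem_inter_iff, mem_compl_iff, hv, this]
      simp
    · simp [q, -mem_Ioo, hv]
  rw [this]
  exact (measurableSet_Ioo.inter measurableSet_Iic).union
    (measurableSet_Ioo.compl.inter (MeasurableSet.const _))

theorem map_quantile (μ : Measure ℝ) [IsProbabilityMeasure μ] {q : ℝ → ℝ} (hqm : Measurable q)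
    (hq : ∀ v ∈ Ioo (0:ℝ) 1, ∀ t, q v ≤ t ↔ v ≤ cdf μ t) :
    (volume.restrict (Ioo (0:ℝ) 1)).map q = μ := by
  refine Measure.ext_of_Iic _ _ fun t => ?_
  rw [Measure.map_apply hqm measurableSet_Iic, Measure.restrict_apply (hqm measurableSet_Iic),
    ← ofReal_cdf]
  have : q ⁻¹' Iic t ∩ Ioo 0 1 = Ioo 0 1 ∩ Iic (cdf μ t) := by
    ext v
    constructor
    · rintro ⟨h, hv⟩
      exact ⟨hv, (hq v hv t).1 h⟩
    · rintro ⟨hv, h⟩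
      exact ⟨(hq v hv t).2 h, hv⟩
  rw [this]
  have h1 := cdf_le_one μ t
  refine le_antisymm ?_ ?_
  · calc volume (Ioo 0 1 ∩ Iic (cdf μ t)) ≤ volume (Ioc 0 (cdf μ t)) :=
        measure_mono fun x hx => ⟨hx.1.1, hx.2⟩
      _ = _ := by simp
  · calc ENNReal.ofReal (cdf μ t) = volume (Ioo 0 (cdf μ t)) := by simp
      _ ≤ volume (Ioo 0 1 ∩ Iic (cdf μ t)) := measure_mono fun x hx => ⟨⟨hx.1, hx.2.trans_le h1⟩, hx.2.le⟩

/-- A periodic measurable function has the same law on all half-open unit intervals. -/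
theorem map_restrict_Ioc_of_periodic {g : ℝ → ℝ} (hg : Measurable g) (hper : Function.Periodic g 1)
    (a b : ℝ) : (volume.restrict (Ioc a (a + 1))).map g = (volume.restrict (Ioc b (b + 1))).map g := by
  ext A hA
  rw [Measure.map_apply hg hA, Measure.map_apply hg hA, Measure.restrict_apply (hg hA),
    Measure.restrict_apply (hg hA)]
  refine (isAddFundamentalDomain_Ioc one_pos a).measure_set_eq
    (isAddFundamentalDomain_Ioc one_pos b) (hg hA) fun n => ?_
  ext x
  simp only [mem_preimage, hper.map_vadd_zmultiples]

theorem ae_ne_intCast : ∀ᵐ u : ℝ, ∀ n : ℤ, u ≠ n :=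
  ae_all_iff.2 fun n => by simp [ae_iff]

/-- The quantile function of a circular distribution function. The function `g` takes values
on the circle and `u ↦ ⌊u⌋ * 2π + g u` is its monotone lift. -/
theorem IsCircleProb.exists_circle_quantile {p : Measure ℝ} (h : IsCircleProb p) :
    ∃ g : ℝ → ℝ, Measurable g ∧
      (∀ α : ℝ, (volume.restrict (Ioc (0:ℝ) 1)).map (fun u => g (u - α)) = p) ∧
      ∀ u : ℝ, (∀ n : ℤ, u ≠ n) → ∀ t, ⌊u⌋ * (2 * π) + g u ≤ t ↔ u ≤ circleCDF p t := by
  have := h.1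
  obtain ⟨q, hqm, hq⟩ := exists_measurable_quantile p
  have hgm : Measurable fun u : ℝ => q (Int.fract u) := hqm.comp measurable_fract
  refine ⟨fun u => q (Int.fract u), hgm, fun α => ?_, fun u hu t => ?_⟩
  · have hmp : MeasurePreserving (fun u : ℝ => u - α) (volume.restrict (Ioc (0:ℝ) 1))
        (volume.restrict (Ioc (-α) (-α + 1))) := by
      have := (measurePreserving_sub_right volume α).restrict_preimage
        (measurableSet_Ioc (a := -α) (b := -α + 1))
      simpa [add_comm] using this
    have hcomp : (volume.restrict (Ioc (0:ℝ) 1)).map (fun u => q (Int.fract (u - α)))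
        = (volume.restrict (Ioc (-α) (-α + 1))).map fun u => q (Int.fract u) := by
      rw [← hmp.map_eq, Measure.map_map hgm hmp.measurable]
      rfl
    rw [hcomp, map_restrict_Ioc_of_periodic hgm (fun x => by simp) (-α) 0, zero_add,
      ← Measure.restrict_congr_set Ioo_ae_eq_Ioc]
    refine Eq.trans (Measure.map_congr ?_) (map_quantile p hqm hq)
    filter_upwards [ae_restrict_mem measurableSet_Ioo] with u hu
    rw [Int.fract_eq_self.2 ⟨hu.1.le, hu.2⟩]
  · have hv : Int.fract u ∈ Ioo (0:ℝ) 1 := by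
      refine ⟨lt_of_le_of_ne (Int.fract_nonneg u) fun h0 => hu ⌊u⌋ ?_, Int.fract_lt_one u⟩
      have := Int.floor_add_fract u
      rw [← h0, add_zero] at this
      exact this.symm
    have hpi := two_pi_pos
    have hu' : u = ⌊u⌋ + Int.fract u := (Int.floor_add_fract u).symm
    rw [← le_sub_iff_add_le', hq _ hv, h.circleCDF_eq]
    have hm1 : ⌊t / (2 * π)⌋ * (2 * π) ≤ t := (le_div_iff₀ hpi).1 (Int.floor_le _)
    have hm2 : t < (⌊t / (2 * π)⌋ + 1) * (2 * π) := (div_lt_iff₀ hpi).1 (Int.lt_floor_add_one _)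
    generalize ⌊t / (2 * π)⌋ = m at *
    generalize ⌊u⌋ = n at *
    rcases lt_trichotomy m n with hmn | rfl | hmn
    · have hmn' : (m : ℝ) + 1 ≤ n := by exact_mod_cast hmn
      rw [h.cdf_eq_zero (t := t - n * (2 * π)) (by nlinarith)]
      have := cdf_le_one p (t - m * (2 * π))
      constructor <;> intro <;> linarith [hv.1, hv.2]
    · constructor <;> intro <;> linarith
    · have hmn' : (n : ℝ) + 1 ≤ m := by exact_mod_cast hmn
      rw [h.cdf_eq_one (t := t - n * (2 * π)) (by nlinarith)]
      have := cdf_nonneg p (t - m * (2 * π))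
      constructor <;> intro <;> linarith [hv.1, hv.2]

/-- Two strips transversal to the translation `(1, T)` of the plane are both fundamental
domains, so they contain the same area of any invariant set. -/
theorem volume_strip_eq_of_invariant {T : ℝ} (hT : 0 < T) {S : Set (ℝ × ℝ)} (hS : MeasurableSet S)
    (hinv : ∀ (n : ℤ) (z : ℝ × ℝ), (z.1 + n, z.2 + n * T) ∈ S ↔ z ∈ S) :
    volume (S ∩ Ioc 0 1 ×ˢ univ) = volume (S ∩ univ ×ˢ Ioc 0 T) := by
  let v : ℝ × ℝ := (1, T)
  have hbij : Function.Bijective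
      (codRestrict (fun n : ℤ => n • v) (AddSubgroup.zmultiples v) fun n => ⟨n, rfl⟩) := by
    refine ⟨fun a b hab => ?_, fun ⟨x, n, hn⟩ => ⟨n, Subtype.ext hn⟩⟩
    have := congrArg (fun x : AddSubgroup.zmultiples v => (x : ℝ × ℝ).1) hab
    simpa [v] using this
  have h1 : IsAddFundamentalDomain (AddSubgroup.zmultiples v) (Ioc (0:ℝ) 1 ×ˢ (univ : Set ℝ)) := by
    refine IsAddFundamentalDomain.mk' (measurableSet_Ioc.prod .univ).nullMeasurableSet fun x => ?_
    refine hbij.existsUnique_iff.2 ?_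
    simpa [AddSubgroup.vadd_def, v, add_comm] using existsUnique_add_zsmul_mem_Ioc one_pos x.1 0
  have h2 : IsAddFundamentalDomain (AddSubgroup.zmultiples v) ((univ : Set ℝ) ×ˢ Ioc (0:ℝ) T) := by
    refine IsAddFundamentalDomain.mk' (MeasurableSet.univ.prod measurableSet_Ioc).nullMeasurableSet
      fun x => ?_
    refine hbij.existsUnique_iff.2 ?_
    simpa [AddSubgroup.vadd_def, v, add_comm] using existsUnique_add_zsmul_mem_Ioc hT x.2 0
  refine h1.measure_set_eq h2 hS ?_
  rintro ⟨_, n, rfl⟩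
  ext z
  rw [← hinv n z]
  simp [AddSubgroup.vadd_def, v, add_comm, Prod.add_def]

theorem volume_setOf_le_xor_le (a b : ℝ) :
    volume {t : ℝ | Xor (a ≤ t) (b ≤ t)} = ENNReal.ofReal |a - b| := by
  have : {t : ℝ | Xor (a ≤ t) (b ≤ t)} = Ico (min a b) (max a b) := by
    ext t
    simp only [mem_ofPred_eq, Xor, mem_Ico, min_le_iff, lt_max_iff]
    grind
  rw [this, Real.volume_Ico, max_sub_min_eq_abs']

theorem volume_setOf_ge_xor_ge (a b : ℝ) :
    volume {t : ℝ | Xor (t ≤ a) (t ≤ b)} = ENNReal.ofReal |a - b| := by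
  have : {t : ℝ | Xor (t ≤ a) (t ≤ b)} = Ioc (min a b) (max a b) := by
    ext t
    simp only [mem_ofPred_eq, Xor, mem_Ioc, min_lt_iff, le_max_iff]
    grind
  rw [this, Real.volume_Ioc, max_sub_min_eq_abs']

theorem circleDist_le_abs {x y : ℝ} (hx : x ∈ Ico 0 (2 * π)) (hy : y ∈ Ico 0 (2 * π)) (m n : ℤ) :
    circleDist x y ≤ |(m * (2 * π) + x) - (n * (2 * π) + y)| := by
  have hpi := two_pi_pos
  have h1 := hx.1
  have h2 := hx.2
  have h3 := hy.1
  have h4 := hy.2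
  rcases lt_trichotomy m n with hmn | rfl | hmn
  · have hmn' : (m : ℝ) + 1 ≤ n := by exact_mod_cast hmn
    refine (min_le_right _ _).trans ?_
    have : x - y ≤ |x - y| := le_abs_self _
    rw [abs_sub_comm _ (n * (2 * π) + y)]
    refine le_trans ?_ (le_abs_self _)
    nlinarith
  · refine (min_le_left _ _).trans (le_of_eq ?_)
    congr 1
    ring
  · have hmn' : (n : ℝ) + 1 ≤ m := by exact_mod_cast hmn
    refine (min_le_right _ _).trans ?_
    have : -(x - y) ≤ |x - y| := neg_le_abs _
    refine le_trans ?_ (le_abs_self _)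
    nlinarith

theorem circleW_one_eq (μ ν : Measure ℝ) : circleW 1 μ ν =
    ⨅ γ ∈ {γ : Measure (ℝ × ℝ) | IsProbabilityMeasure γ ∧ γ.map Prod.fst = μ ∧ γ.map Prod.snd = ν},
      ∫⁻ z, ENNReal.ofReal (circleDist z.1 z.2) ∂γ := by
  simp [circleW]

theorem measurable_circleDist : Measurable fun z : ℝ × ℝ => circleDist z.1 z.2 := by
  have h : Measurable fun z : ℝ × ℝ => |z.1 - z.2| :=
    (continuous_fst.sub continuous_snd).abs.measurable
  exact h.min (h.const_sub _)

/-- Matching the quantiles of `p₁` with the quantiles of `p₂` shifted by `α` bounds the Wasserstein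
distance by the area between the circular distribution functions. -/
theorem circleW_one_le_lintegral {p₁ p₂ : Measure ℝ} (h₁ : IsCircleProb p₁) (h₂ : IsCircleProb p₂)
    (α : ℝ) : circleW 1 p₁ p₂ ≤
      ∫⁻ t in Ioc 0 (2 * π), ENNReal.ofReal |circleCDF p₁ t - circleCDF p₂ t - α| := by
  obtain ⟨g₁, hg₁, hmap₁, hgal₁⟩ := h₁.exists_circle_quantile
  obtain ⟨g₂, hg₂, hmap₂, hgal₂⟩ := h₂.exists_circle_quantile
  have hmap₁ := by simpa only [sub_zero] using hmap₁ 0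
  have hmap₂ := hmap₂ α
  have hg₂' : Measurable fun u => g₂ (u - α) := hg₂.comp (measurable_id.sub_const α)
  have hpair : Measurable fun u => (g₁ u, g₂ (u - α)) := hg₁.prodMk hg₂'
  let S : Set (ℝ × ℝ) := {z | Xor (z.1 ≤ circleCDF p₁ z.2) (z.1 ≤ circleCDF p₂ z.2 + α)}
  have hS : MeasurableSet S := by
    have hA : MeasurableSet {z : ℝ × ℝ | z.1 ≤ circleCDF p₁ z.2} :=
      measurableSet_le measurable_fst (h₁.measurable_circleCDF.comp measurable_snd)
    have hB : MeasurableSet {z : ℝ × ℝ | z.1 ≤ circleCDF p₂ z.2 + α} :=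
      measurableSet_le measurable_fst ((h₂.measurable_circleCDF.comp measurable_snd).add_const α)
    exact (hA.diff hB).union (hB.diff hA)
  have hinv : ∀ (n : ℤ) (z : ℝ × ℝ), (z.1 + n, z.2 + n * (2 * π)) ∈ S ↔ z ∈ S := by
    intro n z
    simp only [S, mem_ofPred_eq, circleCDF_add_zsmul, add_right_comm _ (n : ℝ) α,
      add_le_add_iff_right]
  have hprob : IsProbabilityMeasure (volume.restrict (Ioc (0:ℝ) 1)) := ⟨by simp⟩
  calc circleW 1 p₁ p₂
      ≤ ∫⁻ z, ENNReal.ofReal (circleDist z.1 z.2)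
          ∂(volume.restrict (Ioc (0:ℝ) 1)).map fun u => (g₁ u, g₂ (u - α)) := by
        rw [circleW_one_eq]
        refine iInf₂_le _ ⟨Measure.isProbabilityMeasure_map hpair.aemeasurable, ?_, ?_⟩
        · rw [Measure.map_map measurable_fst hpair]
          exact hmap₁
        · rw [Measure.map_map measurable_snd hpair]
          exact hmap₂
    _ = ∫⁻ u in Ioc 0 1, ENNReal.ofReal (circleDist (g₁ u) (g₂ (u - α))) :=
        lintegral_map measurable_circleDist.ennreal_ofReal hpair
    _ ≤ ∫⁻ u in Ioc 0 1, volume (Prod.mk u ⁻¹' S) := by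
        refine lintegral_mono_ae ?_
        have hx := ae_of_ae_map hg₁.aemeasurable (hmap₁ ▸ h₁.ae_mem_Ico)
        have hy := ae_of_ae_map hg₂'.aemeasurable (hmap₂ ▸ h₂.ae_mem_Ico)
        have hu := ae_restrict_of_ae (s := Ioc (0:ℝ) 1) ae_ne_intCast
        have hu' := ae_restrict_of_ae (s := Ioc (0:ℝ) 1)
          ((measurePreserving_sub_right volume α).quasiMeasurePreserving.ae ae_ne_intCast)
        filter_upwards [hx, hy, hu, hu'] with u hx hy hu hu'
        have : Prod.mk u ⁻¹' S = {t | Xor (⌊u⌋ * (2 * π) + g₁ u ≤ t)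
            (⌊u - α⌋ * (2 * π) + g₂ (u - α) ≤ t)} := by
          ext t
          simp only [S, mem_preimage, mem_ofPred_eq, hgal₁ u hu, hgal₂ _ hu', sub_le_iff_le_add]
        rw [this, volume_setOf_le_xor_le]
        exact ENNReal.ofReal_le_ofReal (circleDist_le_abs hx hy _ _)
    _ = volume (S ∩ Ioc 0 1 ×ˢ univ) := by
        rw [← Measure.restrict_apply hS, Measure.volume_eq_prod, ← Measure.prod_restrict,
          Measure.restrict_univ, Measure.prod_apply hS]
    _ = volume (S ∩ univ ×ˢ Ioc 0 (2 * π)) := volume_strip_eq_of_invariant two_pi_pos hS hinv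
    _ = ∫⁻ t in Ioc 0 (2 * π), volume ((fun u => (u, t)) ⁻¹' S) := by
        rw [← Measure.restrict_apply hS, Measure.volume_eq_prod, ← Measure.prod_restrict,
          Measure.restrict_univ, Measure.prod_apply_symm hS]
    _ = ∫⁻ t in Ioc 0 (2 * π), ENNReal.ofReal |circleCDF p₁ t - circleCDF p₂ t - α| := by
        refine lintegral_congr fun t => ?_
        rw [sub_sub, ← volume_setOf_ge_xor_ge]
        rfl

/-- The winding of a shortest arc from `x` to `y` across the base point `0` of the circle. -/
noncomputable def circleWinding (z : ℝ × ℝ) : ℝ :=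
  if |z.1 - z.2| ≤ π then 0 else if z.1 < z.2 then 1 else -1

theorem abs_circleWinding_le (z : ℝ × ℝ) : |circleWinding z| ≤ 1 := by
  unfold circleWinding
  split_ifs <;> simp

theorem measurable_circleWinding : Measurable circleWinding := by
  refine Measurable.ite ?_ measurable_const (Measurable.ite ?_ measurable_const measurable_const)
  · exact measurableSet_le (continuous_fst.sub continuous_snd).abs.measurable measurable_const
  · exact measurableSet_lt measurable_fst measurable_snd

/-- The signed indicator of a shortest arc from `x` to `y`. -/
noncomputable def circleArc (z : ℝ × ℝ) (t : ℝ) : ℝ :=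
  (Iic t).indicator 1 z.1 - (Iic t).indicator 1 z.2 - circleWinding z

theorem abs_circleArc_le (z : ℝ × ℝ) (t : ℝ) : |circleArc z t| ≤ 3 := by
  have := abs_circleWinding_le z
  rw [abs_le] at this ⊢
  simp only [circleArc, indicator_apply, Pi.one_apply]
  split_ifs <;> constructor <;> linarith

theorem measurable_circleArc : Measurable (Function.uncurry circleArc) := by
  have h1 : Measurable fun w : (ℝ × ℝ) × ℝ => (Iic w.2).indicator (1 : ℝ → ℝ) w.1.1 :=
    Measurable.ite (measurableSet_le (measurable_fst.comp measurable_fst) measurable_snd)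
      measurable_const measurable_const
  have h2 : Measurable fun w : (ℝ × ℝ) × ℝ => (Iic w.2).indicator (1 : ℝ → ℝ) w.1.2 :=
    Measurable.ite (measurableSet_le (measurable_snd.comp measurable_fst) measurable_snd)
      measurable_const measurable_const
  exact (h1.sub h2).sub (measurable_circleWinding.comp measurable_fst)

theorem integral_abs_circleArc {z : ℝ × ℝ} (h1 : z.1 ∈ Ico 0 (2 * π)) (h2 : z.2 ∈ Ico 0 (2 * π)) :
    ∫ t in Ico 0 (2 * π), |circleArc z t| = circleDist z.1 z.2 := by
  obtain ⟨x, y⟩ := z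
  obtain ⟨hx0, hx1⟩ := h1
  obtain ⟨hy0, hy1⟩ := h2
  simp only at hx0 hx1 hy0 hy1
  have hI : Ico (min x y) (max x y) ⊆ Ico 0 (2 * π) :=
    Ico_subset_Ico (le_min hx0 hy0) (max_le hx1.le hy1.le)
  have hvol : volume.real (Ico (min x y) (max x y)) = |x - y| := by
    rw [Real.volume_real_Ico_of_le min_le_max, max_sub_min_eq_abs']
  by_cases h : |x - y| ≤ π
  · have : ∀ t, |circleArc (x, y) t| = (Ico (min x y) (max x y)).indicator 1 t := by
      intro t
      simp only [circleArc, circleWinding, if_pos h, indicator_apply, Pi.one_apply, mem_Iic,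
        mem_Ico, min_le_iff, lt_max_iff]
      grind
    simp_rw [this]
    rw [integral_indicator_one measurableSet_Ico, measureReal_restrict_apply measurableSet_Ico,
      inter_eq_left.2 hI, hvol, circleDist, min_eq_left (by linarith)]
  · have : ∀ t, |circleArc (x, y) t| = (Ico (min x y) (max x y))ᶜ.indicator 1 t := by
      intro t
      have hne : x ≠ y := by
        rintro rfl
        exact h (by simpa using pi_pos.le)
      simp only [circleArc, circleWinding, if_neg h, indicator_apply, Pi.one_apply, mem_Iic,
        mem_compl_iff, mem_Ico, min_le_iff, lt_max_iff]
      grind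
    simp_rw [this]
    rw [integral_indicator_one measurableSet_Ico.compl,
      measureReal_restrict_apply measurableSet_Ico.compl, inter_comm, ← sdiff_eq,
      measureReal_sdiff hI measurableSet_Ico measure_Ico_lt_top.ne, hvol, Real.volume_real_Ico_of_le two_pi_pos.le,
      circleDist, min_eq_right (by linarith), sub_zero]

/-- Every coupling costs at least the area between the circular distribution functions, shifted by
the mean winding of the transport. -/
theorem exists_ofReal_integral_le_cost {p₁ p₂ : Measure ℝ} (h₁ : IsCircleProb p₁)
    (h₂ : IsCircleProb p₂) {γ : Measure (ℝ × ℝ)} [IsProbabilityMeasure γ]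
    (hγ₁ : γ.map Prod.fst = p₁) (hγ₂ : γ.map Prod.snd = p₂) :
    ∃ α ∈ Icc (-1 : ℝ) 1, ENNReal.ofReal
      (∫ t in (0:ℝ)..(2 * π), |circleCDF p₁ t - circleCDF p₂ t - α|) ≤
        ∫⁻ z, ENNReal.ofReal (circleDist z.1 z.2) ∂γ := by
  have hp₁ := h₁.1
  have hp₂ := h₂.1
  have hx : ∀ᵐ z ∂γ, z.1 ∈ Ico 0 (2 * π) :=
    ae_of_ae_map measurable_fst.aemeasurable (hγ₁ ▸ h₁.ae_mem_Ico)
  have hy : ∀ᵐ z ∂γ, z.2 ∈ Ico 0 (2 * π) :=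
    ae_of_ae_map measurable_snd.aemeasurable (hγ₂ ▸ h₂.ae_mem_Ico)
  have hw : Integrable circleWinding γ :=
    .of_bound measurable_circleWinding.aestronglyMeasurable 1 (.of_forall abs_circleWinding_le)
  have hprod : Integrable (Function.uncurry fun z t => |circleArc z t|)
      (γ.prod (volume.restrict (Ico 0 (2 * π)))) :=
    .of_bound measurable_circleArc.abs.aestronglyMeasurable 3
      (.of_forall fun w => by simpa [Function.uncurry] using abs_circleArc_le w.1 w.2)
  have hdist : (fun z => ∫ t in Ico 0 (2 * π), |circleArc z t|) =ᵐ[γ]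
      fun z => circleDist z.1 z.2 := by
    filter_upwards [hx, hy] with z h1 h2 using integral_abs_circleArc h1 h2
  have hind₁ : ∀ t, Integrable (fun z : ℝ × ℝ => (Iic t).indicator (1 : ℝ → ℝ) z.1) γ := fun t =>
    (integrable_const (1 : ℝ)).indicator (measurable_fst measurableSet_Iic)
  have hind₂ : ∀ t, Integrable (fun z : ℝ × ℝ => (Iic t).indicator (1 : ℝ → ℝ) z.2) γ := fun t =>
    (integrable_const (1 : ℝ)).indicator (measurable_snd measurableSet_Iic)
  have hmean : ∀ t ∈ Ico 0 (2 * π), ∫ z, circleArc z t ∂γ =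
      circleCDF p₁ t - circleCDF p₂ t - ∫ z, circleWinding z ∂γ := by
    intro t ht
    have e₁ : ∫ z, (Iic t).indicator (1 : ℝ → ℝ) z.1 ∂γ = circleCDF p₁ t := by
      rw [h₁.circleCDF_eq_cdf ht, cdf_eq_real, ← hγ₁,
        map_measureReal_apply measurable_fst measurableSet_Iic]
      exact integral_indicator_one (measurable_fst measurableSet_Iic)
    have e₂ : ∫ z, (Iic t).indicator (1 : ℝ → ℝ) z.2 ∂γ = circleCDF p₂ t := by
      rw [h₂.circleCDF_eq_cdf ht, cdf_eq_real, ← hγ₂,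
        map_measureReal_apply measurable_snd measurableSet_Iic]
      exact integral_indicator_one (measurable_snd measurableSet_Iic)
    rw [← e₁, ← e₂, ← integral_sub (hind₁ t) (hind₂ t)]
    exact integral_sub ((hind₁ t).sub (hind₂ t)) hw
  refine ⟨∫ z, circleWinding z ∂γ, abs_le.1 ?_, ?_⟩
  · simpa using norm_integral_le_of_norm_le_const (μ := γ) (f := circleWinding) (C := 1)
      (.of_forall abs_circleWinding_le)
  rw [← ofReal_integral_eq_lintegral_ofReal (hprod.integral_prod_left.congr hdist)
    (hdist.mono fun z hz => hz ▸ integral_nonneg fun t => abs_nonneg _)]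
  refine ENNReal.ofReal_le_ofReal ?_
  calc ∫ t in (0:ℝ)..(2 * π), |circleCDF p₁ t - circleCDF p₂ t - ∫ z, circleWinding z ∂γ|
      = ∫ t in Ico 0 (2 * π), |∫ z, circleArc z t ∂γ| := by
        rw [intervalIntegral.integral_of_le two_pi_pos.le, ← integral_Ico_eq_integral_Ioc]
        exact setIntegral_congr_fun measurableSet_Ico fun t ht => by simp only [hmean t ht]
    _ ≤ ∫ t in Ico 0 (2 * π), ∫ z, |circleArc z t| ∂γ :=
        integral_mono_of_nonneg (.of_forall fun t => abs_nonneg _) hprod.integral_prod_right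
          (.of_forall fun t => abs_integral_le_integral_abs)
    _ = ∫ z, (∫ t in Ico 0 (2 * π), |circleArc z t|) ∂γ := (integral_integral_swap hprod).symm
    _ = ∫ z, circleDist z.1 z.2 ∂γ := integral_congr_ae hdist

theorem intervalIntegrable_circleCDF_sub {p₁ p₂ : Measure ℝ} (h₁ : IsCircleProb p₁)
    (h₂ : IsCircleProb p₂) :
    IntervalIntegrable (fun t => circleCDF p₁ t - circleCDF p₂ t) volume 0 (2 * π) := by
  rw [intervalIntegrable_iff_integrableOn_Ico_of_le two_pi_pos.le]
  refine IntegrableOn.of_bound measure_Ico_lt_top (h₁.measurable_circleCDF.sub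
    h₂.measurable_circleCDF).aestronglyMeasurable 1 ?_
  filter_upwards [ae_restrict_mem measurableSet_Ico] with t ht
  rw [h₁.circleCDF_eq_cdf ht, h₂.circleCDF_eq_cdf ht, Real.norm_eq_abs, abs_le]
  constructor <;> linarith [cdf_nonneg p₁ t, cdf_le_one p₁ t, cdf_nonneg p₂ t, cdf_le_one p₂ t]

theorem continuous_integral_abs_sub_const {f : ℝ → ℝ} {a b : ℝ} (hab : a ≤ b)
    (hf : IntervalIntegrable f volume a b) : Continuous fun α => ∫ x in a..b, |f x - α| := by
  have hi : ∀ α : ℝ, IntervalIntegrable (fun x => |f x - α|) volume a b := fun α =>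
    (hf.sub intervalIntegrable_const).abs
  refine (LipschitzWith.of_le_add_mul' (b - a) fun α β => ?_).continuous
  calc ∫ x in a..b, |f x - α| ≤ ∫ x in a..b, (|f x - β| + |α - β|) := by
        refine intervalIntegral.integral_mono_on hab (hi α) ((hi β).add intervalIntegrable_const)
          fun x _ => ?_
        calc |f x - α| = |(f x - β) + (β - α)| := by ring_nf
          _ ≤ |f x - β| + |α - β| := abs_sub_comm α β ▸ abs_add_le _ _
    _ = (∫ x in a..b, |f x - β|) + (b - a) * dist α β := by
        rw [intervalIntegral.integral_add (hi β) intervalIntegrable_const]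
        simp [Real.dist_eq]

/-- `W_1(p_1, p_2) = min_{α ∈ ℝ} ∫_0^{2π} |P_1(x) − P_2(x) − α| dx`,
i.e. `W_1(p_1, p_2)` is the least element of the set of values of the right-hand side. -/
theorem circleW_one_eq_min_cdf (p₁ p₂ : Measure ℝ)
    (h₁ : IsCircleProb p₁) (h₂ : IsCircleProb p₂) :
    IsLeast {c : ℝ | ∃ α : ℝ,
        c = ∫ x in (0:ℝ)..(2 * π), |circleCDF p₁ x - circleCDF p₂ x - α|}
      (circleW 1 p₁ p₂).toReal := by
  let F : ℝ → ℝ := fun α => ∫ x in (0:ℝ)..(2 * π), |circleCDF p₁ x - circleCDF p₂ x - α|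
  have hint := intervalIntegrable_circleCDF_sub h₁ h₂
  have hF0 : ∀ α, 0 ≤ F α := fun α =>
    intervalIntegral.integral_nonneg two_pi_pos.le fun x _ => abs_nonneg _
  have hupper : ∀ α, circleW 1 p₁ p₂ ≤ ENNReal.ofReal (F α) := by
    intro α
    refine (circleW_one_le_lintegral h₁ h₂ α).trans_eq ?_
    simp only [F]
    rw [intervalIntegral.integral_of_le two_pi_pos.le]
    refine (ofReal_integral_eq_lintegral_ofReal ?_ (.of_forall fun x => abs_nonneg _)).symm
    exact (intervalIntegrable_iff_integrableOn_Ioc_of_le two_pi_pos.le).1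
      (hint.sub intervalIntegrable_const).abs
  obtain ⟨α, -, hα⟩ := isCompact_Icc.exists_isMinOn (nonempty_Icc.2 (by norm_num : (-1:ℝ) ≤ 1))
    (continuous_integral_abs_sub_const two_pi_pos.le hint).continuousOn
  have hlower : ENNReal.ofReal (F α) ≤ circleW 1 p₁ p₂ := by
    rw [circleW_one_eq]
    refine le_iInf₂ fun γ ⟨hγ, hγ₁, hγ₂⟩ => ?_
    obtain ⟨β, hβ, hle⟩ := exists_ofReal_integral_le_cost h₁ h₂ hγ₁ hγ₂
    exact (ENNReal.ofReal_le_ofReal (hα hβ)).trans hle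
  refine ⟨⟨α, ?_⟩, ?_⟩
  · rw [le_antisymm (hupper α) hlower, ENNReal.toReal_ofReal (hF0 α)]
  · rintro _ ⟨β, rfl⟩
    exact ENNReal.toReal_le_of_le_ofReal (hF0 β) (hupper β)
end

section
/- Let p ≥ 1 and let p_1, p_2 be Borel probability measures on the circle S¹ with circular cumulative distribution functions P_1, P_2. For α ∈ ℝ set P_{2,α}(x) = P_2(x) − α. Then W_p(p_1, p_2)^p = min_{α ∈ ℝ} ∫_0^1 |P_1^{-1}(u) − P_{2,α}^{-1}(u)|^p du, where F^{-1}(u) = inf{x ∈ ℝ : F(x) ≥ u} denotes the generalized inverse. -/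
open MeasureTheory Real Filter
open scoped ENNReal

/-- The generalized inverse `F^{-1}(u) = inf {x ∈ ℝ : F(x) ≥ u}`. -/
noncomputable def geninv (F : ℝ → ℝ) (u : ℝ) : ℝ := sInf {x : ℝ | u ≤ F x}

section FloorRepresentation

variable {T : ℝ}

lemma integral_floor_sub_div (hT : 0 < T) (x : ℝ) :
    ∫ s in (0:ℝ)..T, (⌊(x - s) / T⌋ : ℝ) =
      x - T / 2 - ∫ v in (0:ℝ)..T, Int.fract (v / T) := by
  have hper : Function.Periodic (fun v : ℝ => Int.fract (v / T)) T := fun v => by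
    simp only [add_div, div_self hT.ne', Int.fract_add_one]
  have hmeas : Measurable fun s : ℝ => Int.fract ((x - s) / T) := by fun_prop
  have hfi : IntervalIntegrable (fun s : ℝ => Int.fract ((x - s) / T)) volume 0 T := by
    rw [intervalIntegrable_iff, Set.uIoc_of_le hT.le, IntegrableOn]
    refine Integrable.of_bound hmeas.aestronglyMeasurable 1 (Eventually.of_forall fun s => ?_)
    rw [Real.norm_eq_abs, abs_of_nonneg (Int.fract_nonneg _)]
    exact (Int.fract_lt_one _).le
  have hli : IntervalIntegrable (fun s : ℝ => (x - s) / T) volume 0 T := by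
    apply Continuous.intervalIntegrable; fun_prop
  have h1 : ∫ s in (0:ℝ)..T, Int.fract ((x - s) / T) = ∫ v in (0:ℝ)..T, Int.fract (v / T) := by
    rw [intervalIntegral.integral_comp_sub_left (fun v => Int.fract (v / T)) x]
    have := hper.intervalIntegral_add_eq (x - T) 0
    simpa using this
  have h2 : ∫ s in (0:ℝ)..T, (x - s) / T = x - T / 2 := by
    rw [intervalIntegral.integral_div, intervalIntegral.integral_sub (by simp) (by simp)]
    simp only [intervalIntegral.integral_const, integral_id, smul_eq_mul]
    field_simp
    ring
  have h3 : (fun s : ℝ => (⌊(x - s) / T⌋ : ℝ)) =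
      fun s => (x - s) / T - Int.fract ((x - s) / T) := by
    funext s
    rw [← Int.self_sub_fract]
  rw [h3, intervalIntegral.integral_sub hli hfi, h1, h2]

lemma abs_floor_sub_div_le (hT : 0 < T) {x M : ℝ} (hx : |x| ≤ M) (s : ℝ) :
    ‖(⌊(x - s) / T⌋ : ℝ)‖ ≤ (M + |s|) / T + 1 := by
  have h1 : |(x - s) / T| ≤ (M + |s|) / T := by
    rw [abs_div, abs_of_pos hT]
    have := abs_sub x s
    gcongr
    linarith
  have h2 := abs_le.1 h1
  rw [Real.norm_eq_abs, abs_le]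
  constructor
  · have := Int.sub_one_lt_floor ((x - s) / T)
    linarith [h2.1]
  · have := Int.floor_le ((x - s) / T)
    linarith [h2.2]

lemma ofReal_sub_eq_lintegral_floor (hT : 0 < T) (x y : ℝ) :
    ENNReal.ofReal (x - y) = ∫⁻ s in Set.Ioc 0 T,
      ENNReal.ofReal ((⌊(x - s) / T⌋ : ℝ) - ⌊(y - s) / T⌋) := by
  have hI : ∀ z : ℝ, Integrable (fun s : ℝ => (⌊(z - s) / T⌋ : ℝ))
      (volume.restrict (Set.Ioc 0 T)) := fun z => by
    have hm : Measurable fun s : ℝ => (⌊(z - s) / T⌋ : ℝ) :=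
      measurable_from_top.comp (by fun_prop : Measurable fun s : ℝ => ⌊(z - s) / T⌋)
    refine Integrable.of_bound hm.aestronglyMeasurable ((|z| + T) / T + 1) ?_
    filter_upwards [ae_restrict_mem measurableSet_Ioc] with s hs
    refine (abs_floor_sub_div_le hT le_rfl s).trans ?_
    rw [abs_of_pos hs.1]
    gcongr
    exact hs.2
  rcases le_total x y with h | h
  · rw [ENNReal.ofReal_of_nonpos (by linarith)]
    symm
    refine (lintegral_congr fun s => ENNReal.ofReal_of_nonpos ?_).trans lintegral_zero
    rw [sub_nonpos]
    exact_mod_cast Int.floor_le_floor (by gcongr)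
  · rw [← ofReal_integral_eq_lintegral_ofReal
      (f := fun s : ℝ => (⌊(x - s) / T⌋ : ℝ) - ⌊(y - s) / T⌋) ((hI x).sub (hI y))]
    · rw [integral_sub (hI x) (hI y), ← intervalIntegral.integral_of_le hT.le,
        ← intervalIntegral.integral_of_le hT.le, integral_floor_sub_div hT,
        integral_floor_sub_div hT]
      congr 1
      ring
    · refine Eventually.of_forall fun s => ?_
      simp only [Pi.zero_apply, sub_nonneg]
      exact_mod_cast Int.floor_le_floor (by gcongr)

end FloorRepresentation

lemma ofReal_rpow_eq_lintegral {p : ℝ} (hp : 1 < p) (z : ℝ) :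
    ENNReal.ofReal z ^ p = ∫⁻ t in Set.Ioi (0:ℝ),
      ENNReal.ofReal (p * (p - 1) * t ^ (p - 2)) * ENNReal.ofReal (z - t) := by
  rcases le_or_gt z 0 with hz | hz
  · rw [ENNReal.ofReal_of_nonpos hz, ENNReal.zero_rpow_of_pos (by linarith)]
    symm
    rw [setLIntegral_congr_fun (g := fun _ => 0) measurableSet_Ioi, lintegral_zero]
    intro t ht
    simp only [Set.mem_Ioi] at ht
    simp [ENNReal.ofReal_of_nonpos (by linarith : z - t ≤ 0)]
  have hi1 : IntervalIntegrable (fun t : ℝ => p * (p - 1) * z * t ^ (p - 2)) volume 0 z :=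
    (intervalIntegral.intervalIntegrable_rpow' (by linarith)).const_mul _
  have hi2 : IntervalIntegrable (fun t : ℝ => p * (p - 1) * t ^ (p - 1)) volume 0 z :=
    (intervalIntegral.intervalIntegrable_rpow' (by linarith)).const_mul _
  have hval : ∫ t in (0:ℝ)..z, (p * (p - 1) * z * t ^ (p - 2) - p * (p - 1) * t ^ (p - 1)) =
      z ^ p := by
    rw [intervalIntegral.integral_sub hi1 hi2, intervalIntegral.integral_const_mul,
      intervalIntegral.integral_const_mul, integral_rpow (Or.inl (by linarith)),
      integral_rpow (Or.inl (by linarith)), Real.zero_rpow (by linarith),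
      Real.zero_rpow (by linarith), show p - 2 + 1 = p - 1 by ring, show p - 1 + 1 = p by ring,
      Real.rpow_sub_one hz.ne']
    have : p - 1 ≠ 0 := by linarith
    field_simp
    ring
  have hsplit : ∫⁻ t in Set.Ioi (0:ℝ),
      ENNReal.ofReal (p * (p - 1) * t ^ (p - 2)) * ENNReal.ofReal (z - t) =
      ∫⁻ t in Set.Ioc (0:ℝ) z,
      ENNReal.ofReal (p * (p - 1) * z * t ^ (p - 2) - p * (p - 1) * t ^ (p - 1)) := by
    rw [← Set.Ioc_union_Ioi_eq_Ioi hz.le, lintegral_union measurableSet_Ioi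
      (Set.Ioc_disjoint_Ioi le_rfl)]
    rw [setLIntegral_congr_fun (s := Set.Ioi z) (g := fun _ => 0) measurableSet_Ioi,
      lintegral_zero, add_zero]
    · refine setLIntegral_congr_fun measurableSet_Ioc fun t ht => ?_
      have ht0 : 0 < t := ht.1
      have hpos : 0 ≤ p * (p - 1) * t ^ (p - 2) :=
        mul_nonneg (mul_nonneg (by linarith) (by linarith)) (Real.rpow_nonneg ht0.le _)
      rw [← ENNReal.ofReal_mul hpos]
      congr 1
      have : t ^ (p - 1) = t ^ (p - 2) * t := by
        rw [← Real.rpow_add_one ht0.ne']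
        congr 1
        ring
      rw [this]
      ring
    · intro t ht
      simp only [Set.mem_Ioi] at ht
      simp [ENNReal.ofReal_of_nonpos (by linarith : z - t ≤ 0)]
  rw [hsplit, ← ofReal_integral_eq_lintegral_ofReal,
    ← intervalIntegral.integral_of_le hz.le, hval,
    ENNReal.ofReal_rpow_of_nonneg hz.le (by linarith)]
  · have := hi1.sub hi2
    rwa [intervalIntegrable_iff_integrableOn_Ioc_of_le hz.le] at this
  · filter_upwards [ae_restrict_mem measurableSet_Ioc] with t ht
    have ht0 : 0 < t := ht.1
    have : t ^ (p - 1) = t ^ (p - 2) * t := by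
      rw [← Real.rpow_add_one ht0.ne']
      congr 1
      ring
    rw [this]
    have hpos : 0 ≤ p * (p - 1) * t ^ (p - 2) :=
      mul_nonneg (mul_nonneg (by linarith) (by linarith)) (Real.rpow_nonneg ht0.le _)
    have := mul_nonneg hpos (sub_nonneg.2 ht.2)
    simp only [Pi.zero_apply]
    linarith

section Comparison

variable {Ω Ω' : Type*} [MeasurableSpace Ω] [MeasurableSpace Ω'] {μ : Measure Ω}
  {ν : Measure Ω'}

lemma lintegral_ofReal_rpow_le_of_hinge [IsFiniteMeasure μ] [IsFiniteMeasure ν] {p : ℝ}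
    (hp : 1 ≤ p) {D : Ω → ℝ} {E : Ω' → ℝ} (hD : Measurable D) (hE : Measurable E)
    (h : ∀ t, ∫⁻ ω, ENNReal.ofReal (D ω - t) ∂μ ≤ ∫⁻ ω, ENNReal.ofReal (E ω - t) ∂ν) :
    ∫⁻ ω, ENNReal.ofReal (D ω) ^ p ∂μ ≤ ∫⁻ ω, ENNReal.ofReal (E ω) ^ p ∂ν := by
  rcases hp.eq_or_lt with rfl | hp
  · simpa using h 0
  simp only [ofReal_rpow_eq_lintegral hp]
  rw [lintegral_lintegral_swap (μ := μ) (by fun_prop),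
    lintegral_lintegral_swap (μ := ν) (by fun_prop)]
  refine lintegral_mono fun t => ?_
  rw [lintegral_const_mul _ (by fun_prop), lintegral_const_mul _ (by fun_prop)]
  gcongr
  exact h t

lemma ofReal_integral_le_lintegral_ofReal {f : Ω → ℝ} (hf : Integrable f μ) :
    ENNReal.ofReal (∫ ω, f ω ∂μ) ≤ ∫⁻ ω, ENNReal.ofReal (f ω) ∂μ := by
  rw [integral_eq_lintegral_pos_part_sub_lintegral_neg_part hf]
  refine (ENNReal.ofReal_le_ofReal (sub_le_self _ ENNReal.toReal_nonneg)).trans ?_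
  exact ENNReal.ofReal_toReal_le

variable {T M : ℝ}

lemma measurable_floor_sub_div {X : Ω → ℝ} (hX : Measurable X) (s : ℝ) :
    Measurable fun ω => (⌊(X ω - s) / T⌋ : ℝ) :=
  measurable_from_top.comp (by fun_prop : Measurable fun ω => ⌊(X ω - s) / T⌋)

lemma integrable_floor_sub_div [IsFiniteMeasure μ] (hT : 0 < T) {X : Ω → ℝ} (hX : Measurable X)
    (hM : ∀ᵐ ω ∂μ, |X ω| ≤ M) (s : ℝ) :
    Integrable (fun ω => (⌊(X ω - s) / T⌋ : ℝ)) μ := by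
  refine Integrable.of_bound (measurable_floor_sub_div hX s).aestronglyMeasurable
    ((M + |s|) / T + 1) ?_
  filter_upwards [hM] with ω hω using abs_floor_sub_div_le hT hω s

variable {X Y : Ω → ℝ} {X' Y' : Ω' → ℝ}

variable [IsFiniteMeasure μ]

lemma lintegral_ofReal_sub_eq_lintegral_floor (hT : 0 < T) (hX : Measurable X)
    (hY : Measurable Y) :
    ∫⁻ ω, ENNReal.ofReal (X ω - Y ω) ∂μ = ∫⁻ s in Set.Ioc 0 T,
      ∫⁻ ω, ENNReal.ofReal ((⌊(X ω - s) / T⌋ : ℝ) - ⌊(Y ω - s) / T⌋) ∂μ := by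
  have hm : ∀ {Z : Ω → ℝ}, Measurable Z →
      Measurable (Function.uncurry fun (ω : Ω) (s : ℝ) => (⌊(Z ω - s) / T⌋ : ℝ)) := fun hZ =>
    measurable_from_top.comp (by fun_prop : Measurable fun q : Ω × ℝ => ⌊(_ - q.2) / T⌋)
  rw [← lintegral_lintegral_swap ((hm hX).sub (hm hY)).ennreal_ofReal.aemeasurable]
  exact lintegral_congr fun ω => ofReal_sub_eq_lintegral_floor hT _ _

variable [IsFiniteMeasure ν]

lemma lintegral_hinge_le_of_comonotone (hT : 0 < T)
    (hX : Measurable X) (hY : Measurable Y) (hX' : Measurable X') (hY' : Measurable Y')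
    (bX : ∀ᵐ ω ∂μ, |X ω| ≤ M) (bY : ∀ᵐ ω ∂μ, |Y ω| ≤ M)
    (bX' : ∀ᵐ ω ∂ν, |X' ω| ≤ M) (bY' : ∀ᵐ ω ∂ν, |Y' ω| ≤ M)
    (eX : ∀ s, ∫ ω, (⌊(X ω - s) / T⌋ : ℝ) ∂μ = ∫ ω, (⌊(X' ω - s) / T⌋ : ℝ) ∂ν)
    (eY : ∀ s, ∫ ω, (⌊(Y ω - s) / T⌋ : ℝ) ∂μ = ∫ ω, (⌊(Y' ω - s) / T⌋ : ℝ) ∂ν)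
    (hco : ∀ s r, (∀ ω, ⌊(X ω - s) / T⌋ ≤ ⌊(Y ω - r) / T⌋) ∨
      ∀ ω, ⌊(Y ω - r) / T⌋ ≤ ⌊(X ω - s) / T⌋) (t : ℝ) :
    ∫⁻ ω, ENNReal.ofReal (X ω - Y ω - t) ∂μ ≤ ∫⁻ ω, ENNReal.ofReal (X' ω - Y' ω - t) ∂ν := by
  simp only [sub_sub]
  rw [lintegral_ofReal_sub_eq_lintegral_floor hT hX (hY.add_const t),
    lintegral_ofReal_sub_eq_lintegral_floor hT hX' (hY'.add_const t)]
  refine lintegral_mono fun s => ?_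
  have hadd : ∀ y : ℝ, y + t - s = y - (s - t) := fun y => by ring
  simp only [hadd]
  rcases hco s (s - t) with h | h
  · refine (le_of_eq ?_).trans zero_le
    refine (lintegral_congr fun ω => ENNReal.ofReal_of_nonpos ?_).trans lintegral_zero
    rw [sub_nonpos]
    exact_mod_cast h ω
  · have i1 := integrable_floor_sub_div hT hX bX s
    have i2 := integrable_floor_sub_div hT hY bY (s - t)
    have i3 := integrable_floor_sub_div hT hX' bX' s
    have i4 := integrable_floor_sub_div hT hY' bY' (s - t)
    rw [← ofReal_integral_eq_lintegral_ofReal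
      (f := fun ω => (⌊(X ω - s) / T⌋ : ℝ) - ⌊(Y ω - (s - t)) / T⌋) (i1.sub i2)]
    · rw [integral_sub i1 i2, eX, eY, ← integral_sub i3 i4]
      exact ofReal_integral_le_lintegral_ofReal (i3.sub i4)
    · refine Eventually.of_forall fun ω => ?_
      simp only [Pi.zero_apply, sub_nonneg]
      exact_mod_cast h ω

lemma ofReal_abs_rpow {p : ℝ} (hp : 0 < p) (z : ℝ) :
    ENNReal.ofReal |z| ^ p = ENNReal.ofReal z ^ p + ENNReal.ofReal (-z) ^ p := by
  rcases le_total 0 z with h | h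
  · rw [abs_of_nonneg h, ENNReal.ofReal_of_nonpos (neg_nonpos.2 h), ENNReal.zero_rpow_of_pos hp,
      add_zero]
  · rw [abs_of_nonpos h, ENNReal.ofReal_of_nonpos h, ENNReal.zero_rpow_of_pos hp, zero_add]

/-- Among pairs of bounded random variables with prescribed mean step functions
`s ↦ E ⌊(X - s) / T⌋`, the comonotone ones minimize `E |X - Y| ^ p`. -/
theorem lintegral_abs_sub_rpow_le_of_comonotone {p : ℝ} (hp : 1 ≤ p) (hT : 0 < T)
    (hX : Measurable X) (hY : Measurable Y) (hX' : Measurable X') (hY' : Measurable Y')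
    (bX : ∀ᵐ ω ∂μ, |X ω| ≤ M) (bY : ∀ᵐ ω ∂μ, |Y ω| ≤ M)
    (bX' : ∀ᵐ ω ∂ν, |X' ω| ≤ M) (bY' : ∀ᵐ ω ∂ν, |Y' ω| ≤ M)
    (eX : ∀ s, ∫ ω, (⌊(X ω - s) / T⌋ : ℝ) ∂μ = ∫ ω, (⌊(X' ω - s) / T⌋ : ℝ) ∂ν)
    (eY : ∀ s, ∫ ω, (⌊(Y ω - s) / T⌋ : ℝ) ∂μ = ∫ ω, (⌊(Y' ω - s) / T⌋ : ℝ) ∂ν)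
    (hco : ∀ s r, (∀ ω, ⌊(X ω - s) / T⌋ ≤ ⌊(Y ω - r) / T⌋) ∨
      ∀ ω, ⌊(Y ω - r) / T⌋ ≤ ⌊(X ω - s) / T⌋) :
    ∫⁻ ω, ENNReal.ofReal |X ω - Y ω| ^ p ∂μ ≤ ∫⁻ ω, ENNReal.ofReal |X' ω - Y' ω| ^ p ∂ν := by
  simp only [ofReal_abs_rpow (zero_lt_one.trans_le hp), neg_sub]
  rw [lintegral_add_left (by fun_prop), lintegral_add_left (by fun_prop)]
  refine add_le_add
    (lintegral_ofReal_rpow_le_of_hinge hp (hX.sub hY) (hX'.sub hY')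
      (lintegral_hinge_le_of_comonotone hT hX hY hX' hY' bX bY bX' bY' eX eY hco))
    (lintegral_ofReal_rpow_le_of_hinge hp (hY.sub hX) (hY'.sub hX')
      (lintegral_hinge_le_of_comonotone hT hY hX hY' hX' bY bX bY' bX' eY eX
        fun s r => (hco r s).symm))

end Comparison

section CircleCDF

variable {q : Measure ℝ}

lemma IsCircleProb.ae_mem_Ico_s5 (hq : IsCircleProb q) : ∀ᵐ x ∂q, x ∈ Set.Ico 0 (2 * π) := by
  have := hq.1
  exact (mem_ae_iff_prob_eq_one measurableSet_Ico).2 hq.2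

lemma IsCircleProb.measureReal_Icc (hq : IsCircleProb q) (y : ℝ) :
    (q (Set.Icc 0 y)).toReal = ProbabilityTheory.cdf q y := by
  have := hq.1
  rw [ProbabilityTheory.cdf_eq_real, Measure.real]
  congr 1
  refine measure_congr ?_
  filter_upwards [hq.ae_mem_Ico_s5] with x hx
  exact propext ⟨fun h => h.2, fun h => ⟨hx.1, h⟩⟩

lemma IsCircleProb.circleCDF_eq_s5 (hq : IsCircleProb q) (x : ℝ) :
    circleCDF q x = ⌊x / (2 * π)⌋ + ProbabilityTheory.cdf q (x - 2 * π * ⌊x / (2 * π)⌋) := by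
  have hT : (0:ℝ) < 2 * π := by positivity
  rw [circleCDF, hq.measureReal_Icc, Int.fract, mul_sub, mul_div_cancel₀ _ hT.ne']

lemma circleCDF_add_two_pi (x : ℝ) : circleCDF q (x + 2 * π) = circleCDF q x + 1 := by
  have hT : (0:ℝ) < 2 * π := by positivity
  rw [circleCDF, circleCDF, add_div, div_self hT.ne', Int.floor_add_one, Int.fract_add_one]
  push_cast
  ring

lemma IsCircleProb.circleCDF_mono (hq : IsCircleProb q) : Monotone (circleCDF q) := by
  have := hq.1
  intro x y hxy
  have hT : (0:ℝ) < 2 * π := by positivity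
  rw [hq.circleCDF_eq_s5, hq.circleCDF_eq_s5]
  have hfl : ⌊x / (2 * π)⌋ ≤ ⌊y / (2 * π)⌋ := Int.floor_le_floor (by gcongr)
  rcases hfl.eq_or_lt with h | h
  · rw [h]
    gcongr
  · have h' : (⌊x / (2 * π)⌋ : ℝ) + 1 ≤ ⌊y / (2 * π)⌋ := by exact_mod_cast h
    have := ProbabilityTheory.cdf_le_one q (x - 2 * π * ⌊x / (2 * π)⌋)
    have := ProbabilityTheory.cdf_nonneg q (y - 2 * π * ⌊y / (2 * π)⌋)
    linarith

lemma IsCircleProb.circleCDF_rightContinuous (hq : IsCircleProb q) (x : ℝ) :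
    ContinuousWithinAt (circleCDF q) (Set.Ioi x) x := by
  have hT : (0:ℝ) < 2 * π := by positivity
  set n := ⌊x / (2 * π)⌋ with hn
  have hc : ContinuousWithinAt
      (fun y : ℝ => (n : ℝ) + ProbabilityTheory.cdf q (y - 2 * π * n)) (Set.Ioi x) x := by
    refine continuousWithinAt_const.add ?_
    refine ((ProbabilityTheory.cdf q).right_continuous (x - 2 * π * n)).comp
      (f := fun y : ℝ => y - 2 * π * n) (by fun_prop) ?_
    intro y hy
    simp only [Set.mem_Ioi, Set.mem_Ici] at *
    linarith
  refine hc.congr_of_eventuallyEq ?_ (hq.circleCDF_eq_s5 x)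
  have hlt : x < 2 * π * (n + 1) := by
    have := Int.lt_floor_add_one (x / (2 * π))
    rw [div_lt_iff₀ hT] at this
    linarith
  filter_upwards [Ioo_mem_nhdsGT hlt] with y hy
  have hfl : ⌊y / (2 * π)⌋ = n := by
    rw [Int.floor_eq_iff, le_div_iff₀ hT, div_lt_iff₀ hT]
    have := Int.floor_le (x / (2 * π))
    rw [le_div_iff₀ hT] at this
    constructor
    · linarith [hy.1]
    · linarith [hy.2]
  rw [hq.circleCDF_eq_s5, hfl]

lemma IsCircleProb.circleCDF_of_neg (hq : IsCircleProb q) {x : ℝ} (hx : x < 0) :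
    circleCDF q x ≤ 0 := by
  have := hq.1
  have hT : (0:ℝ) < 2 * π := by positivity
  rw [hq.circleCDF_eq_s5]
  have h1 : ⌊x / (2 * π)⌋ ≤ -1 := by
    have : ⌊x / (2 * π)⌋ < 0 := Int.floor_lt.2 (by simpa using div_neg_of_neg_of_pos hx hT)
    omega
  have h2 : (⌊x / (2 * π)⌋ : ℝ) ≤ -1 := by exact_mod_cast h1
  have := ProbabilityTheory.cdf_le_one q (x - 2 * π * ⌊x / (2 * π)⌋)
  linarith

lemma IsCircleProb.circleCDF_of_mem (hq : IsCircleProb q) {x : ℝ} (h0 : 0 ≤ x)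
    (hx : x < 2 * π) : circleCDF q x = ProbabilityTheory.cdf q x := by
  have hT : (0:ℝ) < 2 * π := by positivity
  have : ⌊x / (2 * π)⌋ = 0 := by
    rw [Int.floor_eq_zero_iff]
    exact ⟨by positivity, (div_lt_one hT).2 hx⟩
  rw [hq.circleCDF_eq_s5, this]
  simp

lemma IsCircleProb.one_le_circleCDF (hq : IsCircleProb q) {x : ℝ} (hx : 2 * π ≤ x) :
    1 ≤ circleCDF q x := by
  have := hq.1
  have h0 : circleCDF q 0 = ProbabilityTheory.cdf q 0 :=
    hq.circleCDF_of_mem le_rfl (by positivity)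
  have h1 := circleCDF_add_two_pi (q := q) 0
  have h2 := hq.circleCDF_mono hx
  have := ProbabilityTheory.cdf_nonneg q 0
  rw [zero_add] at h1
  linarith

lemma circleCDF_add_nat (x : ℝ) (n : ℕ) :
    circleCDF q (x + n * (2 * π)) = circleCDF q x + n := by
  induction n with
  | zero => simp
  | succ n ih =>
    rw [Nat.cast_succ, add_mul, one_mul, ← add_assoc, circleCDF_add_two_pi, ih]
    ring

lemma circleCDF_sub_nat (x : ℝ) (n : ℕ) :
    circleCDF q (x - n * (2 * π)) = circleCDF q x - n := by
  have := circleCDF_add_nat (q := q) (x - n * (2 * π)) n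
  rw [sub_add_cancel] at this
  linarith

lemma superlevel_circleCDF_nonempty (u : ℝ) : {x : ℝ | u ≤ circleCDF q x}.Nonempty := by
  obtain ⟨n, hn⟩ := exists_nat_ge (u - circleCDF q 0)
  refine ⟨0 + n * (2 * π), ?_⟩
  rw [Set.mem_ofPred_eq, circleCDF_add_nat]
  linarith

lemma IsCircleProb.superlevel_bddBelow (hq : IsCircleProb q) (u : ℝ) :
    BddBelow {x : ℝ | u ≤ circleCDF q x} := by
  obtain ⟨n, hn⟩ := exists_nat_gt (circleCDF q 0 - u)
  refine ⟨0 - n * (2 * π), fun x hx => ?_⟩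
  by_contra! h
  have := hq.circleCDF_mono h.le
  rw [circleCDF_sub_nat] at this
  have : u ≤ circleCDF q x := hx
  linarith

lemma IsCircleProb.geninv_le_iff (hq : IsCircleProb q) {u x : ℝ} :
    geninv (circleCDF q) u ≤ x ↔ u ≤ circleCDF q x := by
  refine ⟨fun h => ?_, fun h => csInf_le (hq.superlevel_bddBelow u) h⟩
  refine le_trans ?_ (hq.circleCDF_mono h)
  refine ge_of_tendsto (hq.circleCDF_rightContinuous (geninv (circleCDF q) u)) ?_
  filter_upwards [self_mem_nhdsWithin] with y hy
  obtain ⟨z, hz, hzy⟩ := exists_lt_of_csInf_lt (superlevel_circleCDF_nonempty u) hy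
  exact le_trans hz (hq.circleCDF_mono hzy.le)

lemma IsCircleProb.geninv_mono (hq : IsCircleProb q) : Monotone (geninv (circleCDF q)) :=
  fun _ _ h => hq.geninv_le_iff.2 (h.trans (hq.geninv_le_iff.1 le_rfl))

lemma IsCircleProb.geninv_add_one (hq : IsCircleProb q) (u : ℝ) :
    geninv (circleCDF q) (u + 1) = geninv (circleCDF q) u + 2 * π := by
  refine eq_of_forall_ge_iff fun x => ?_
  rw [hq.geninv_le_iff, ← le_sub_iff_add_le, ← le_sub_iff_add_le, hq.geninv_le_iff]
  have := circleCDF_add_two_pi (q := q) (x - 2 * π)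
  rw [sub_add_cancel] at this
  rw [this, add_sub_cancel_right]

lemma geninv_sub_const (F : ℝ → ℝ) (α u : ℝ) :
    geninv (fun x => F x - α) u = geninv F (u + α) := by
  simp only [geninv, le_sub_iff_add_le]

lemma IsCircleProb.map_geninv (hq : IsCircleProb q) :
    (volume.restrict (Set.Ioc (0:ℝ) 1)).map (geninv (circleCDF q)) = q := by
  have := hq.1
  refine Measure.ext_of_Iic _ _ fun x => ?_
  rw [Measure.map_apply hq.geninv_mono.measurable measurableSet_Iic]
  have hpre : geninv (circleCDF q) ⁻¹' Set.Iic x = Set.Iic (circleCDF q x) := by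
    ext u
    exact hq.geninv_le_iff
  rw [hpre, Measure.restrict_apply measurableSet_Iic, Set.inter_comm, Set.Ioc_inter_Iic,
    Real.volume_Ioc, sub_zero]
  have hcdf : q (Set.Iic x) = ENNReal.ofReal (ProbabilityTheory.cdf q x) := by
    rw [ProbabilityTheory.ofReal_cdf]
  have h1 := ProbabilityTheory.cdf_le_one q x
  rcases lt_or_ge x 0 with h | h
  · rw [inf_eq_right.2 ((hq.circleCDF_of_neg h).trans zero_le_one),
      ENNReal.ofReal_of_nonpos (hq.circleCDF_of_neg h)]
    symm
    rw [measure_eq_zero_iff_ae_notMem]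
    filter_upwards [hq.ae_mem_Ico_s5] with y hy hyx
    exact absurd (hy.1.trans hyx) (not_le.2 h)
  · rcases lt_or_ge x (2 * π) with h' | h'
    · rw [hq.circleCDF_of_mem h h', inf_eq_right.2 h1, hcdf]
    · rw [inf_eq_left.2 (hq.one_le_circleCDF h'), ENNReal.ofReal_one]
      symm
      rw [← mem_ae_iff_prob_eq_one measurableSet_Iic]
      filter_upwards [hq.ae_mem_Ico_s5] with y hy
      exact hy.2.le.trans h'

lemma IsCircleProb.geninv_mem_Ico (hq : IsCircleProb q) :
    ∀ᵐ u ∂(volume.restrict (Set.Ioc (0:ℝ) 1)), geninv (circleCDF q) u ∈ Set.Ico 0 (2 * π) := by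
  have := hq.ae_mem_Ico_s5
  rw [← hq.map_geninv] at this
  exact ae_of_ae_map hq.geninv_mono.measurable.aemeasurable this

end CircleCDF

section Equivariant

lemma le_or_le_of_monotone_of_add_one {f g : ℝ → ℤ} (hf : Monotone f) (hg : Monotone g)
    (f_add : ∀ u, f (u + 1) = f u + 1) (g_add : ∀ u, g (u + 1) = g u + 1) :
    (∀ u, f u ≤ g u) ∨ ∀ u, g u ≤ f u := by
  by_contra! h
  obtain ⟨⟨v, hv⟩, u, hu⟩ := h
  have hper : Function.Periodic (fun u => g u - f u) 1 := fun w => by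
    simp only [f_add, g_add]
    ring
  have hw := hper.sub_zsmul_eq (x := v) ⌈v - u⌉
  simp only [zsmul_eq_mul, mul_one] at hw
  have h1 : v - ⌈v - u⌉ ≤ u := by linarith [Int.le_ceil (v - u)]
  have h2 : u - 1 ≤ v - ⌈v - u⌉ := by linarith [Int.ceil_lt_add_one (v - u)]
  have h3 := hf h1
  have h4 := hg h2
  have h5 := g_add (u - 1)
  rw [sub_add_cancel] at h5
  omega

lemma integral_comp_add_of_add_one {f : ℝ → ℝ} (hf : Monotone f)
    (f_add : ∀ u, f (u + 1) = f u + 1) (α : ℝ) :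
    ∫ u in Set.Ioc (0:ℝ) 1, f (u + α) = (∫ u in Set.Ioc (0:ℝ) 1, f u) + α := by
  rw [← intervalIntegral.integral_of_le zero_le_one, ← intervalIntegral.integral_of_le zero_le_one]
  have hper : Function.Periodic (fun u => f u - u) 1 := fun u => by
    simp only [f_add]
    ring
  have h := hper.intervalIntegral_add_eq α 0
  rw [intervalIntegral.integral_sub hf.intervalIntegrable intervalIntegral.intervalIntegrable_id,
    intervalIntegral.integral_sub hf.intervalIntegrable intervalIntegral.intervalIntegrable_id,
    integral_id, integral_id] at h
  rw [intervalIntegral.integral_comp_add_right, zero_add, add_comm 1 α]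
  rw [zero_add] at h
  linarith

end Equivariant

section Cost

variable {q q₁ q₂ : Measure ℝ}

lemma circleDist_fract_le {x : ℝ} (hx : x ∈ Set.Ico 0 (2 * π)) (y : ℝ) :
    circleDist x (Int.fract (y / (2 * π)) * (2 * π)) ≤ |x - y| := by
  have hT : (0:ℝ) < 2 * π := by positivity
  set n := ⌊y / (2 * π)⌋ with hn
  set z := Int.fract (y / (2 * π)) * (2 * π) with hz
  have hy : y = z + n * (2 * π) := by
    rw [hz, ← add_mul, Int.fract_add_floor, div_mul_cancel₀ _ hT.ne']
  have z0 : 0 ≤ z := mul_nonneg (Int.fract_nonneg _) hT.le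
  have z1 : z < 2 * π := by
    have := mul_lt_mul_of_pos_right (Int.fract_lt_one (y / (2 * π))) hT
    linarith
  obtain ⟨x0, x1⟩ := hx
  rw [circleDist, hy]
  rcases lt_trichotomy n 0 with h | h | h
  · refine (min_le_right _ _).trans ?_
    have h' : (n : ℝ) ≤ -1 := by exact_mod_cast (by omega : n ≤ -1)
    have : (n : ℝ) * (2 * π) ≤ -1 * (2 * π) := by gcongr
    have := neg_abs_le (x - z)
    refine le_trans ?_ (le_abs_self _)
    linarith
  · rw [h]
    simp
  · refine (min_le_right _ _).trans ?_
    have h' : (1 : ℝ) ≤ n := by exact_mod_cast h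
    have : 1 * (2 * π) ≤ (n : ℝ) * (2 * π) := by gcongr
    have := le_abs_self (x - z)
    refine le_trans ?_ (neg_le_abs _)
    linarith

lemma IsCircleProb.map_fract_geninv (hq : IsCircleProb q) (α : ℝ) :
    (volume.restrict (Set.Ioc (0:ℝ) 1)).map
      (fun u => Int.fract (geninv (circleCDF q) (u + α) / (2 * π)) * (2 * π)) = q := by
  have := hq.1
  have hT : (0:ℝ) < 2 * π := by positivity
  have hQ : Measurable (geninv (circleCDF q)) := hq.geninv_mono.measurable
  have hm : ∀ β, Measurable fun u : ℝ =>
      Int.fract (geninv (circleCDF q) (u + β) / (2 * π)) * (2 * π) := fun β => by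
    have : Measurable fun u : ℝ => geninv (circleCDF q) (u + β) := by fun_prop
    fun_prop
  have hshift : (volume.restrict (Set.Ioc (0:ℝ) 1)).map
      (fun u => Int.fract (geninv (circleCDF q) (u + α) / (2 * π)) * (2 * π)) =
      (volume.restrict (Set.Ioc (0:ℝ) 1)).map
      (fun u => Int.fract (geninv (circleCDF q) (u + 0) / (2 * π)) * (2 * π)) := by
    ext A hA
    rw [← measureReal_eq_measureReal_iff]
    have key : ∀ β, ((volume.restrict (Set.Ioc (0:ℝ) 1)).map
        (fun u => Int.fract (geninv (circleCDF q) (u + β) / (2 * π)) * (2 * π))).real A =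
        ∫ u in (0:ℝ)..1, A.indicator (1 : ℝ → ℝ)
          (Int.fract (geninv (circleCDF q) u / (2 * π)) * (2 * π)) := fun β => by
      have hper : Function.Periodic (fun u => A.indicator (1 : ℝ → ℝ)
          (Int.fract (geninv (circleCDF q) u / (2 * π)) * (2 * π))) 1 := fun u => by
        simp only [hq.geninv_add_one, add_div, div_self hT.ne', Int.fract_add_one]
      have h := hper.intervalIntegral_add_eq β 0
      rw [← integral_indicator_one hA, integral_map (hm β).aemeasurable
        ((measurable_one.indicator hA).aestronglyMeasurable),
        ← intervalIntegral.integral_of_le zero_le_one,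
        intervalIntegral.integral_comp_add_right (fun u => A.indicator (1 : ℝ → ℝ)
          (Int.fract (geninv (circleCDF q) u / (2 * π)) * (2 * π))), zero_add, add_comm 1 β, h,
          zero_add]
    rw [key, key]
  rw [hshift]
  conv_rhs => rw [← hq.map_geninv]
  refine Measure.map_congr ?_
  filter_upwards [hq.geninv_mem_Ico] with u hu
  rw [add_zero, Int.fract_eq_self.2 ⟨div_nonneg hu.1 hT.le, (div_lt_one hT).2 hu.2⟩,
    div_mul_cancel₀ _ hT.ne']

lemma abs_le_max_of_monotone {Q : ℝ → ℝ} (hQ : Monotone Q) {a b u : ℝ} (h : u ∈ Set.Icc a b) :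
    |Q u| ≤ max |Q a| |Q b| :=
  abs_le_max_abs_abs (hQ h.1) (hQ h.2)

lemma ofReal_integral_quantile {p : ℝ} (hp : 1 ≤ p) {Q R : ℝ → ℝ} (hQ : Monotone Q)
    (hR : Monotone R) :
    ENNReal.ofReal (∫ u in (0:ℝ)..1, |Q u - R u| ^ p) =
      ∫⁻ u in Set.Ioc (0:ℝ) 1, ENNReal.ofReal |Q u - R u| ^ p := by
  have hQm := hQ.measurable
  have hRm := hR.measurable
  rw [intervalIntegral.integral_of_le zero_le_one, ofReal_integral_eq_lintegral_ofReal]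
  · refine lintegral_congr fun u => ?_
    rw [ENNReal.ofReal_rpow_of_nonneg (abs_nonneg _) (by linarith)]
  · refine Integrable.of_bound ((hQm.sub hRm).abs.pow_const p).aestronglyMeasurable
      ((max |Q 0| |Q 1| + max |R 0| |R 1|) ^ p) ?_
    filter_upwards [ae_restrict_mem measurableSet_Ioc] with u hu
    rw [Real.norm_eq_abs, abs_of_nonneg (by positivity)]
    have h1 := abs_le_max_of_monotone hQ (Set.Ioc_subset_Icc_self hu)
    have h2 := abs_le_max_of_monotone hR (Set.Ioc_subset_Icc_self hu)
    have h3 := abs_sub (Q u) (R u)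
    gcongr
    linarith
  · exact Eventually.of_forall fun u => by positivity

lemma continuous_integral_quantile_shift {p : ℝ} (hp : 1 ≤ p) {Q R : ℝ → ℝ} (hQ : Monotone Q)
    (hR : Monotone R) :
    Continuous fun α : ℝ => ∫ u in (0:ℝ)..1, |Q u - R (u + α)| ^ p := by
  have hQm := hQ.measurable
  have hRm := hR.measurable
  rw [continuous_iff_continuousAt]
  intro α
  have hball : Set.Icc (α - 1) (α + 1) ∈ nhds α := Icc_mem_nhds (by linarith) (by linarith)
  refine intervalIntegral.continuousAt_of_dominated_interval
    (bound := fun _ => (max |Q 0| |Q 1| + max |R (α - 1)| |R (α + 2)|) ^ p) ?_ ?_ (by simp) ?_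
  · refine Eventually.of_forall fun β => ?_
    have : Measurable fun u : ℝ => R (u + β) := by fun_prop
    exact ((hQm.sub this).abs.pow_const p).aestronglyMeasurable
  · filter_upwards [hball] with β hβ
    refine Eventually.of_forall fun u hu => ?_
    rw [Set.uIoc_of_le zero_le_one] at hu
    rw [Real.norm_eq_abs, abs_of_nonneg (by positivity)]
    have h1 := abs_le_max_of_monotone hQ (Set.Ioc_subset_Icc_self hu)
    have h2 := abs_le_max_of_monotone hR (a := α - 1) (b := α + 2) (u := u + β)
      ⟨by linarith [hu.1, hβ.1], by linarith [hu.2, hβ.2]⟩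
    have h3 := abs_sub (Q u) (R (u + β))
    gcongr
    linarith
  · have hnull : volume {u : ℝ | ¬ ContinuousAt R (u + α)} = 0 := by
      refine Set.Countable.measure_zero ?_ _
      exact hR.countable_not_continuousAt.preimage (add_left_injective α)
    filter_upwards [measure_eq_zero_iff_ae_notMem.1 hnull] with u hu _
    have hu' : ContinuousAt R (u + α) := not_not.1 hu
    have : ContinuousAt (fun β => R (u + β)) α :=
      ContinuousAt.comp (f := fun β => u + β) hu' (by fun_prop)
    exact ((continuousAt_const.sub this).abs).rpow_const (Or.inr (by linarith))

/-- The cost of the monotone rearrangement whose second quantile function is shifted by `α`. -/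
noncomputable def quantileCost (p : ℝ) (q₁ q₂ : Measure ℝ) (α : ℝ) : ℝ :=
  ∫ u in (0:ℝ)..1, |geninv (circleCDF q₁) u - geninv (circleCDF q₂) (u + α)| ^ p

lemma quantileCost_nonneg (p : ℝ) (q₁ q₂ : Measure ℝ) (α : ℝ) : 0 ≤ quantileCost p q₁ q₂ α :=
  intervalIntegral.integral_nonneg zero_le_one fun _ _ => by positivity

lemma ofReal_quantileCost {p : ℝ} (hp : 1 ≤ p) (h₁ : IsCircleProb q₁) (h₂ : IsCircleProb q₂)
    (α : ℝ) : ENNReal.ofReal (quantileCost p q₁ q₂ α) = ∫⁻ u in Set.Ioc (0:ℝ) 1,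
      ENNReal.ofReal |geninv (circleCDF q₁) u - geninv (circleCDF q₂) (u + α)| ^ p :=
  ofReal_integral_quantile hp h₁.geninv_mono (R := fun u => geninv (circleCDF q₂) (u + α))
    fun _ _ h => h₂.geninv_mono (by linarith)

lemma circleW_le_quantileCost {p : ℝ} (hp : 1 ≤ p) (h₁ : IsCircleProb q₁)
    (h₂ : IsCircleProb q₂) (α : ℝ) :
    circleW p q₁ q₂ ≤ ENNReal.ofReal (quantileCost p q₁ q₂ α) ^ (1 / p) := by
  have := h₁.1
  have m₁ : Measurable (geninv (circleCDF q₁)) := h₁.geninv_mono.measurable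
  have m₂ : Measurable (geninv (circleCDF q₂)) := h₂.geninv_mono.measurable
  have m₃ : Measurable fun u : ℝ =>
      Int.fract (geninv (circleCDF q₂) (u + α) / (2 * π)) * (2 * π) := by
    have : Measurable fun u : ℝ => geninv (circleCDF q₂) (u + α) := by fun_prop
    fun_prop
  have hd : Measurable fun z : ℝ × ℝ => ENNReal.ofReal (circleDist z.1 z.2) ^ p := by
    unfold circleDist
    fun_prop
  set γ : Measure (ℝ × ℝ) := (volume.restrict (Set.Ioc (0:ℝ) 1)).map fun u =>
    (geninv (circleCDF q₁) u, Int.fract (geninv (circleCDF q₂) (u + α) / (2 * π)) * (2 * π))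
    with hγ
  have hfst : γ.map Prod.fst = q₁ := by
    rw [hγ, Measure.map_map measurable_fst (m₁.prodMk m₃)]
    exact h₁.map_geninv
  have hsnd : γ.map Prod.snd = q₂ := by
    rw [hγ, Measure.map_map measurable_snd (m₁.prodMk m₃)]
    exact h₂.map_fract_geninv α
  have hprob : IsProbabilityMeasure γ := by
    constructor
    rw [← Set.preimage_univ (f := Prod.fst), ← Measure.map_apply measurable_fst .univ, hfst,
      measure_univ]
  refine (iInf₂_le γ ⟨hprob, hfst, hsnd⟩).trans ?_
  refine ENNReal.rpow_le_rpow ?_ (by positivity)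
  rw [ofReal_quantileCost hp h₁ h₂, hγ, lintegral_map hd (m₁.prodMk m₃)]
  refine lintegral_mono_ae ?_
  filter_upwards [h₁.geninv_mem_Ico] with u hu
  exact ENNReal.rpow_le_rpow (ENNReal.ofReal_le_ofReal (circleDist_fract_le hu _)) (by linarith)

/-- The integer `k` for which `y + 2πk` is a lift of `y` closest to `x`, for `x, y ∈ [0, 2π)`. -/
noncomputable def windingShift (x y : ℝ) : ℤ :=
  if 2 * |x - y| ≤ 2 * π then 0 else if y < x then 1 else -1

lemma abs_sub_windingShift {x y : ℝ} (hx : x ∈ Set.Ico 0 (2 * π)) (hy : y ∈ Set.Ico 0 (2 * π)) :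
    |x - (y + 2 * π * windingShift x y)| = circleDist x y := by
  obtain ⟨x0, x1⟩ := hx
  obtain ⟨y0, y1⟩ := hy
  rw [windingShift, circleDist]
  split_ifs with h1 h2
  · rw [min_eq_left (by linarith)]
    simp
  · rw [min_eq_right (by linarith), abs_of_pos (sub_pos.2 h2), abs_of_nonpos (by
      push_cast; linarith)]
    push_cast
    ring
  · rw [min_eq_right (by linarith), abs_of_nonpos (by linarith : x - y ≤ 0),
      abs_of_nonneg (by push_cast; linarith)]
    push_cast
    ring

lemma abs_windingShift_le (x y : ℝ) : |(windingShift x y : ℝ)| ≤ 1 := by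
  rw [windingShift]
  split_ifs <;> simp

lemma measurable_windingShift : Measurable fun z : ℝ × ℝ => windingShift z.1 z.2 := by
  unfold windingShift
  refine Measurable.ite (measurableSet_le (by fun_prop) (by fun_prop)) measurable_const ?_
  exact Measurable.ite (measurableSet_lt (by fun_prop) (by fun_prop)) measurable_const
    measurable_const

lemma IsCircleProb.integral_floor_geninv (hq : IsCircleProb q) (s : ℝ) :
    ∫ u in Set.Ioc (0:ℝ) 1, (⌊(geninv (circleCDF q) u - s) / (2 * π)⌋ : ℝ) =
      ∫ x, (⌊(x - s) / (2 * π)⌋ : ℝ) ∂q := by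
  have hfl : Measurable fun x : ℝ => (⌊(x - s) / (2 * π)⌋ : ℝ) :=
    measurable_floor_sub_div measurable_id s
  conv_rhs => rw [← hq.map_geninv]
  rw [integral_map hq.geninv_mono.measurable.aemeasurable hfl.aestronglyMeasurable]

lemma exists_quantileCost_le {p : ℝ} (hp : 1 ≤ p) (h₁ : IsCircleProb q₁) (h₂ : IsCircleProb q₂)
    {γ : Measure (ℝ × ℝ)} [IsProbabilityMeasure γ] (hfst : γ.map Prod.fst = q₁)
    (hsnd : γ.map Prod.snd = q₂) :
    ∃ α ∈ Set.Icc (-1:ℝ) 1, ENNReal.ofReal (quantileCost p q₁ q₂ α) ≤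
      ∫⁻ z, ENNReal.ofReal (circleDist z.1 z.2) ^ p ∂γ := by
  have hT : (0:ℝ) < 2 * π := by positivity
  have ae₁ : ∀ᵐ z ∂γ, z.1 ∈ Set.Ico 0 (2 * π) :=
    ae_of_ae_map measurable_fst.aemeasurable (hfst ▸ h₁.ae_mem_Ico_s5)
  have ae₂ : ∀ᵐ z ∂γ, z.2 ∈ Set.Ico 0 (2 * π) :=
    ae_of_ae_map measurable_snd.aemeasurable (hsnd ▸ h₂.ae_mem_Ico_s5)
  have mk : Measurable fun z : ℝ × ℝ => (windingShift z.1 z.2 : ℝ) :=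
    measurable_from_top.comp measurable_windingShift
  have ik : Integrable (fun z : ℝ × ℝ => (windingShift z.1 z.2 : ℝ)) γ :=
    Integrable.of_bound mk.aestronglyMeasurable 1
      (Eventually.of_forall fun z => abs_windingShift_le _ _)
  set α := ∫ z, (windingShift z.1 z.2 : ℝ) ∂γ with hα
  have hα1 : |α| ≤ 1 := by
    have := norm_integral_le_of_norm_le_const (μ := γ) (C := 1)
      (f := fun z => (windingShift z.1 z.2 : ℝ)) (Eventually.of_forall fun z : ℝ × ℝ => abs_windingShift_le z.1 z.2)
    simpa using this
  refine ⟨α, abs_le.1 hα1, ?_⟩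
  have Q₁ := h₁.geninv_mono
  have Q₂ := h₂.geninv_mono
  have m₁ := Q₁.measurable
  have m₂ := Q₂.measurable
  have mfl : ∀ s, Measurable fun x : ℝ => (⌊(x - s) / (2 * π)⌋ : ℝ) := fun s =>
    measurable_floor_sub_div measurable_id s
  have mono : ∀ {q : Measure ℝ}, IsCircleProb q → ∀ s β,
      Monotone fun u : ℝ => ⌊(geninv (circleCDF q) (u + β) - s) / (2 * π)⌋ := by
    intro q hq s β u v huv
    have := hq.geninv_mono (by linarith : u + β ≤ v + β)
    exact Int.floor_le_floor (by gcongr)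
  have shift : ∀ {q : Measure ℝ}, IsCircleProb q → ∀ s β u,
      ⌊(geninv (circleCDF q) (u + 1 + β) - s) / (2 * π)⌋ =
        ⌊(geninv (circleCDF q) (u + β) - s) / (2 * π)⌋ + 1 := by
    intro q hq s β u
    rw [add_right_comm, hq.geninv_add_one, add_sub_right_comm, add_div, div_self hT.ne',
      Int.floor_add_one]
  set M := max (max |geninv (circleCDF q₁) 0| |geninv (circleCDF q₁) 1|)
    (max (max |geninv (circleCDF q₂) (0 + α)| |geninv (circleCDF q₂) (1 + α)|) (4 * π))
  have hMπ : 4 * π ≤ M := (le_max_right _ _).trans (le_max_right _ _)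
  have main := lintegral_abs_sub_rpow_le_of_comonotone (μ := volume.restrict (Set.Ioc (0:ℝ) 1))
    (ν := γ) (X := geninv (circleCDF q₁)) (Y := fun u => geninv (circleCDF q₂) (u + α))
    (X' := fun z => z.1) (Y' := fun z => z.2 + 2 * π * windingShift z.1 z.2) (M := M) hp hT
    m₁ (by fun_prop) (by fun_prop) (by fun_prop) ?_ ?_ ?_ ?_ ?_ ?_ ?_
  · rw [ofReal_quantileCost hp h₁ h₂]
    refine main.trans (le_of_eq (lintegral_congr_ae ?_))
    filter_upwards [ae₁, ae₂] with z hz₁ hz₂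
    rw [abs_sub_windingShift hz₁ hz₂]
  · filter_upwards [ae_restrict_mem measurableSet_Ioc] with u hu
    exact (abs_le_max_of_monotone Q₁ (Set.Ioc_subset_Icc_self hu)).trans (le_max_left _ _)
  · filter_upwards [ae_restrict_mem measurableSet_Ioc] with u hu
    refine (abs_le_max_of_monotone Q₂ (a := 0 + α) (b := 1 + α)
      ⟨by linarith [hu.1], by linarith [hu.2]⟩).trans ?_
    exact (le_max_left _ _).trans (le_max_right _ _)
  · filter_upwards [ae₁] with z hz
    rw [abs_of_nonneg hz.1]
    linarith [hz.2]
  · filter_upwards [ae₂] with z hz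
    refine (abs_add_le _ _).trans ?_
    rw [abs_of_nonneg hz.1, abs_mul, abs_of_pos hT]
    have := mul_le_mul_of_nonneg_left (abs_windingShift_le z.1 z.2) hT.le
    linarith [hz.2]
  · intro s
    rw [h₁.integral_floor_geninv, ← hfst, integral_map measurable_fst.aemeasurable
      (mfl s).aestronglyMeasurable]
  · intro s
    have hfl : ∀ z : ℝ × ℝ, (⌊(z.2 + 2 * π * windingShift z.1 z.2 - s) / (2 * π)⌋ : ℝ) =
        (⌊(z.2 - s) / (2 * π)⌋ : ℝ) + windingShift z.1 z.2 := fun z => by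
      rw [add_sub_right_comm, add_div, mul_div_cancel_left₀ _ hT.ne', Int.floor_add_intCast]
      push_cast
      ring
    have ifl : Integrable (fun z : ℝ × ℝ => (⌊(z.2 - s) / (2 * π)⌋ : ℝ)) γ := by
      refine integrable_floor_sub_div hT measurable_snd (M := 2 * π) ?_ s
      filter_upwards [ae₂] with z hz
      rw [abs_of_nonneg hz.1]
      exact hz.2.le
    simp only [hfl]
    rw [integral_add ifl ik, ← hα, ← integral_map (f := fun x : ℝ => (⌊(x - s) / (2 * π)⌋ : ℝ))
      measurable_snd.aemeasurable (mfl s).aestronglyMeasurable, hsnd,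
      ← h₂.integral_floor_geninv]
    refine integral_comp_add_of_add_one
      (f := fun u => (⌊(geninv (circleCDF q₂) u - s) / (2 * π)⌋ : ℝ)) (fun u v huv => ?_)
      (fun u => ?_) α
    · have := mono h₂ s 0 huv
      simp only [add_zero] at this
      simpa using this
    · have := shift h₂ s 0 u
      simp only [add_zero] at this
      exact_mod_cast this
  · intro s r
    have hmono := mono h₁ s 0
    have hshift := shift h₁ s 0
    simp only [add_zero] at hmono hshift
    exact le_or_le_of_monotone_of_add_one hmono (mono h₂ r α) hshift (shift h₂ r α)

end Cost

/-- `W_p(p_1, p_2)^p = min_{α ∈ ℝ} ∫_0^1 |P_1^{-1}(u) − P_{2,α}^{-1}(u)|^p du`,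
where `P_{2,α}(x) = P_2(x) − α`; i.e. `W_p(p_1, p_2)^p` is the least element of the set of
values of the right-hand side. -/
theorem circleW_pow_eq_min_quantile {p : ℝ} (hp : 1 ≤ p) (p₁ p₂ : Measure ℝ)
    (h₁ : IsCircleProb p₁) (h₂ : IsCircleProb p₂) :
    IsLeast {c : ℝ | ∃ α : ℝ,
        c = ∫ u in (0:ℝ)..1,
          |geninv (circleCDF p₁) u - geninv (fun x => circleCDF p₂ x - α) u| ^ p}
      ((circleW p p₁ p₂).toReal ^ p) := by
  have hp0 : 0 < p := by linarith
  have hset : ∀ α : ℝ, (∫ u in (0:ℝ)..1,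
      |geninv (circleCDF p₁) u - geninv (fun x => circleCDF p₂ x - α) u| ^ p) =
        quantileCost p p₁ p₂ α := fun α => by
    simp only [geninv_sub_const]
    rfl
  simp only [hset]
  have hpow : ∀ α, (ENNReal.ofReal (quantileCost p p₁ p₂ α) ^ (1 / p)).toReal ^ p =
      quantileCost p p₁ p₂ α := fun α => by
    have h0 := quantileCost_nonneg p p₁ p₂ α
    rw [← ENNReal.toReal_rpow, ENNReal.toReal_ofReal h0, ← Real.rpow_mul h0,
      one_div_mul_cancel hp0.ne', Real.rpow_one]
  constructor
  · obtain ⟨α, -, hα⟩ := isCompact_Icc.exists_isMinOn (s := Set.Icc (-1:ℝ) 1)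
      (f := quantileCost p p₁ p₂) ⟨0, by norm_num⟩
      (continuous_integral_quantile_shift hp h₁.geninv_mono h₂.geninv_mono).continuousOn
    refine ⟨α, ?_⟩
    have hW : circleW p p₁ p₂ = ENNReal.ofReal (quantileCost p p₁ p₂ α) ^ (1 / p) := by
      refine le_antisymm (circleW_le_quantileCost hp h₁ h₂ α) ?_
      refine le_iInf₂ fun γ hγ => ?_
      have := hγ.1
      obtain ⟨β, hβ, hle⟩ := exists_quantileCost_le hp h₁ h₂ hγ.2.1 hγ.2.2
      refine ENNReal.rpow_le_rpow (le_trans ?_ hle) (by positivity)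
      exact ENNReal.ofReal_le_ofReal (hα hβ)
    rw [hW, hpow]
  · rintro c ⟨α, rfl⟩
    rw [← hpow α]
    refine Real.rpow_le_rpow ENNReal.toReal_nonneg ?_ hp0.le
    refine ENNReal.toReal_mono ?_ (circleW_le_quantileCost hp h₁ h₂ α)
    exact ENNReal.rpow_ne_top_of_nonneg (by positivity) ENNReal.ofReal_ne_top
end

section
/- For every ρ ∈ (0,1) and μ ∈ [0, 2π), the Fisher information matrix of the wrapped Cauchy family p(x | μ, ρ) = (1/(2π)) (1 − ρ²)/(1 + ρ² − 2ρ cos(x − μ)) with respect to (μ, ρ) is diagonal, with entries I_{μμ} = 2ρ²/(1 − ρ²)² and I_{ρρ} = 2/(1 − ρ²)². Explicitly: ∫_0^{2π} (∂_μ log p(x | μ, ρ))² p(x | μ, ρ) dx = 2ρ²/(1 − ρ²)², ∫_0^{2π} (∂_ρ log p(x | μ, ρ))² p(x | μ, ρ) dx = 2/(1 − ρ²)², and ∫_0^{2π} (∂_μ log p)(∂_ρ log p) p(x | μ, ρ) dx = 0. -/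
open MeasureTheory Real Filter
open scoped ENNReal

/-- The wrapped Cauchy density on `[0, 2π)` with mean direction `μ` and
concentration `ρ`. -/
noncomputable def wrappedCauchy (μ ρ x : ℝ) : ℝ :=
  (1 / (2 * π)) * (1 - ρ ^ 2) / (1 + ρ ^ 2 - 2 * ρ * Real.cos (x - μ))

lemma wrappedCauchy_denom_pos {ρ : ℝ} (hρ : |ρ| < 1) (t : ℝ) :
    0 < 1 + ρ ^ 2 - 2 * ρ * cos t := by
  have h : ρ ^ 2 < 1 := (sq_lt_one_iff_abs_lt_one ρ).2 hρ
  have hc : (ρ * cos t) ^ 2 ≤ ρ ^ 2 := by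
    rw [mul_pow]
    exact mul_le_of_le_one_right (sq_nonneg ρ) (cos_sq_le_one t)
  nlinarith [sq_nonneg (1 - ρ * cos t)]

lemma integral_shift_eq_of_hasDerivAt {F f : ℝ → ℝ} {C : ℝ} (hF : ∀ t, HasDerivAt F (f t) t)
    (hf : Continuous f) (hC : ∀ t, F (t + 2 * π) = F t + C) (μ : ℝ) :
    ∫ x in (0 : ℝ)..(2 * π), f (x - μ) = C := by
  rw [intervalIntegral.integral_comp_sub_right,
    intervalIntegral.integral_eq_sub_of_hasDerivAt (fun t _ => hF t) (hf.intervalIntegrable _ _),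
    show 2 * π - μ = 0 - μ + 2 * π by ring, hC]
  ring

lemma hasDerivAt_wrappedCauchy_denom (ρ t : ℝ) :
    HasDerivAt (fun t => 1 + ρ ^ 2 - 2 * ρ * cos t) (2 * ρ * sin t) t := by
  simpa using ((hasDerivAt_cos t).const_mul (2 * ρ)).const_sub (1 + ρ ^ 2)

lemma hasDerivAt_poissonKernel_primitive {ρ : ℝ} (hρ : |ρ| < 1) (t : ℝ) :
    HasDerivAt (fun t => t + 2 * arctan (ρ * sin t / (1 - ρ * cos t)))
      ((1 - ρ ^ 2) / (1 + ρ ^ 2 - 2 * ρ * cos t)) t := by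
  have hD := wrappedCauchy_denom_pos hρ t
  have h1 : 1 - ρ * cos t ≠ 0 := by
    have := sq_lt_one_iff_abs_lt_one ρ |>.2 hρ
    nlinarith
  have h := (((hasDerivAt_sin t).const_mul ρ).div
    (((hasDerivAt_cos t).const_mul ρ).const_sub 1) h1).arctan
  refine ((hasDerivAt_id t).add (h.const_mul 2)).congr_deriv ?_
  have hs : sin t ^ 2 = 1 - cos t ^ 2 := sin_sq t
  have hE : 1 + (ρ * sin t / (1 - ρ * cos t)) ^ 2 =
      (1 + ρ ^ 2 - 2 * ρ * cos t) / (1 - ρ * cos t) ^ 2 := by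
    field_simp
    rw [hs]
    ring
  simp only [Pi.div_apply, hE]
  field_simp
  ring_nf
  rw [hs]
  ring

lemma integral_wrappedCauchy {ρ : ℝ} (hρ : |ρ| < 1) (μ : ℝ) :
    ∫ x in (0 : ℝ)..(2 * π), wrappedCauchy μ ρ x = 1 := by
  have hD := wrappedCauchy_denom_pos hρ
  have h := integral_shift_eq_of_hasDerivAt (C := 2 * π) (hasDerivAt_poissonKernel_primitive hρ)
    (by fun_prop (disch := exact fun t => (hD t).ne')) (fun t => by simp; ring) μ
  have hp (x : ℝ) : wrappedCauchy μ ρ x =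
      (1 / (2 * π)) * ((1 - ρ ^ 2) / (1 + ρ ^ 2 - 2 * ρ * cos (x - μ))) := mul_div_assoc _ _ _
  simp_rw [hp, intervalIntegral.integral_const_mul]
  rw [h]
  field_simp

lemma continuous_wrappedCauchy {ρ : ℝ} (hρ : |ρ| < 1) (μ : ℝ) :
    Continuous (wrappedCauchy μ ρ) := by
  have hD := wrappedCauchy_denom_pos hρ
  unfold wrappedCauchy
  fun_prop (disch := exact fun x => (hD (x - μ)).ne')

lemma integral_sin_sq_div_denom_cube {ρ : ℝ} (hρ : |ρ| < 1) (hρ0 : ρ ≠ 0) (μ : ℝ) :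
    ∫ x in (0 : ℝ)..(2 * π), sin (x - μ) ^ 2 / (1 + ρ ^ 2 - 2 * ρ * cos (x - μ)) ^ 3 =
      π / (1 - ρ ^ 2) ^ 3 := by
  have hD := wrappedCauchy_denom_pos hρ
  have hρ2 : 1 - ρ ^ 2 ≠ 0 := (sub_pos.2 ((sq_lt_one_iff_abs_lt_one ρ).2 hρ)).ne'
  refine integral_shift_eq_of_hasDerivAt
    (f := fun t => sin t ^ 2 / (1 + ρ ^ 2 - 2 * ρ * cos t) ^ 3)
    (F := fun t => 1 / (4 * ρ) *
      (1 / (1 - ρ ^ 2) ^ 2 * ((1 + ρ ^ 2) * (sin t / (1 + ρ ^ 2 - 2 * ρ * cos t)) +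
        2 * ρ / (1 - ρ ^ 2) * (t + 2 * arctan (ρ * sin t / (1 - ρ * cos t)))) -
      sin t / (1 + ρ ^ 2 - 2 * ρ * cos t) ^ 2)) (fun t => ?_)
    (by fun_prop (disch := exact fun t => pow_ne_zero _ (hD t).ne')) (fun t => ?_) μ
  · have hDt := (hD t).ne'
    have h1 := (hasDerivAt_sin t).div (hasDerivAt_wrappedCauchy_denom ρ t) hDt
    have h2 := (hasDerivAt_sin t).div ((hasDerivAt_wrappedCauchy_denom ρ t).pow 2)
      (pow_ne_zero 2 hDt)
    refine ((((h1.const_mul (1 + ρ ^ 2)).add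
      ((hasDerivAt_poissonKernel_primitive hρ t).const_mul (2 * ρ / (1 - ρ ^ 2)))).const_mul
      (1 / (1 - ρ ^ 2) ^ 2)).sub h2 |>.const_mul (1 / (4 * ρ))).congr_deriv ?_
    simp only [Pi.pow_apply, Nat.add_one_sub_one, pow_one, Nat.cast_ofNat]
    field_simp
    rw [sin_sq]
    ring
  · simp only [sin_add_two_pi, cos_add_two_pi]
    field_simp
    ring

lemma deriv_log_wrappedCauchy_mean {ρ : ℝ} (hρ : |ρ| < 1) (μ x : ℝ) :
    deriv (fun m => log (wrappedCauchy m ρ x)) μ =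
      2 * ρ * sin (x - μ) / (1 + ρ ^ 2 - 2 * ρ * cos (x - μ)) := by
  have hD := (wrappedCauchy_denom_pos hρ (x - μ)).ne'
  have hρ2 : 1 - ρ ^ 2 ≠ 0 := (sub_pos.2 ((sq_lt_one_iff_abs_lt_one ρ).2 hρ)).ne'
  have hd : HasDerivAt (fun m => 1 + ρ ^ 2 - 2 * ρ * cos (x - m)) (-(2 * ρ * sin (x - μ))) μ := by
    simpa [Function.comp_def] using (hasDerivAt_wrappedCauchy_denom ρ (x - μ)).comp μ
      ((hasDerivAt_id μ).const_sub x)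
  have hn : 1 / (2 * π) * (1 - ρ ^ 2) ≠ 0 := by positivity
  refine (((hasDerivAt_const μ (1 / (2 * π) * (1 - ρ ^ 2))).div hd hD).log
    (div_ne_zero hn hD)).deriv.trans ?_
  simp only [Pi.div_apply]
  field_simp
  ring

lemma deriv_log_wrappedCauchy_concentration {ρ : ℝ} (hρ : |ρ| < 1) (μ x : ℝ) :
    deriv (fun r => log (wrappedCauchy μ r x)) ρ =
      2 * ((1 + ρ ^ 2) * cos (x - μ) - 2 * ρ) /
        ((1 - ρ ^ 2) * (1 + ρ ^ 2 - 2 * ρ * cos (x - μ))) := by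
  have hD := (wrappedCauchy_denom_pos hρ (x - μ)).ne'
  have hρ2 : 1 - ρ ^ 2 ≠ 0 := (sub_pos.2 ((sq_lt_one_iff_abs_lt_one ρ).2 hρ)).ne'
  have hd : HasDerivAt (fun r : ℝ => 1 + r ^ 2 - 2 * r * cos (x - μ))
      (2 * ρ - 2 * cos (x - μ)) ρ := by
    simpa using ((hasDerivAt_pow 2 ρ).const_add 1).fun_sub
      (((hasDerivAt_id ρ).const_mul 2).mul_const (cos (x - μ)))
  have hn : HasDerivAt (fun r : ℝ => 1 / (2 * π) * (1 - r ^ 2)) (1 / (2 * π) * -(2 * ρ)) ρ := by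
    simpa using ((hasDerivAt_pow 2 ρ).const_sub 1).const_mul (1 / (2 * π))
  have hn0 : 1 / (2 * π) * (1 - ρ ^ 2) ≠ 0 := by positivity
  refine ((hn.div hd hD).log (div_ne_zero hn0 hD)).deriv.trans ?_
  simp only [Pi.div_apply]
  field_simp
  ring

lemma integral_score_mean_sq {ρ : ℝ} (hρ : |ρ| < 1) (hρ0 : ρ ≠ 0) (μ : ℝ) :
    ∫ x in (0 : ℝ)..(2 * π),
      (2 * ρ * sin (x - μ) / (1 + ρ ^ 2 - 2 * ρ * cos (x - μ))) ^ 2 * wrappedCauchy μ ρ x =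
      2 * ρ ^ 2 / (1 - ρ ^ 2) ^ 2 := by
  have hρ2 : 1 - ρ ^ 2 ≠ 0 := (sub_pos.2 ((sq_lt_one_iff_abs_lt_one ρ).2 hρ)).ne'
  have h (x : ℝ) : (2 * ρ * sin (x - μ) / (1 + ρ ^ 2 - 2 * ρ * cos (x - μ))) ^ 2 *
      wrappedCauchy μ ρ x = 4 * ρ ^ 2 * (1 - ρ ^ 2) / (2 * π) *
        (sin (x - μ) ^ 2 / (1 + ρ ^ 2 - 2 * ρ * cos (x - μ)) ^ 3) := by
    have hD := (wrappedCauchy_denom_pos hρ (x - μ)).ne'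
    unfold wrappedCauchy
    field_simp
    ring
  simp_rw [h, intervalIntegral.integral_const_mul]
  rw [integral_sin_sq_div_denom_cube hρ hρ0]
  field_simp
  ring

lemma integral_score_concentration_sq {ρ : ℝ} (hρ : |ρ| < 1) (hρ0 : ρ ≠ 0) (μ : ℝ) :
    ∫ x in (0 : ℝ)..(2 * π),
      (2 * ((1 + ρ ^ 2) * cos (x - μ) - 2 * ρ) /
        ((1 - ρ ^ 2) * (1 + ρ ^ 2 - 2 * ρ * cos (x - μ)))) ^ 2 * wrappedCauchy μ ρ x =
      2 / (1 - ρ ^ 2) ^ 2 := by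
  have hρ2 : 1 - ρ ^ 2 ≠ 0 := (sub_pos.2 ((sq_lt_one_iff_abs_lt_one ρ).2 hρ)).ne'
  have hD := wrappedCauchy_denom_pos hρ
  have hp := continuous_wrappedCauchy hρ μ
  have h (x : ℝ) : (2 * ((1 + ρ ^ 2) * cos (x - μ) - 2 * ρ) /
        ((1 - ρ ^ 2) * (1 + ρ ^ 2 - 2 * ρ * cos (x - μ)))) ^ 2 * wrappedCauchy μ ρ x =
      4 / (1 - ρ ^ 2) ^ 2 * wrappedCauchy μ ρ x - 1 / ρ ^ 2 *
        ((2 * ρ * sin (x - μ) / (1 + ρ ^ 2 - 2 * ρ * cos (x - μ))) ^ 2 *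
          wrappedCauchy μ ρ x) := by
    have hDx := (hD (x - μ)).ne'
    rw [← mul_assoc, ← sub_mul]
    congr 1
    field_simp
    rw [sin_sq]
    ring
  simp_rw [h]
  rw [intervalIntegral.integral_sub, intervalIntegral.integral_const_mul,
    intervalIntegral.integral_const_mul, integral_score_mean_sq hρ hρ0, integral_wrappedCauchy hρ]
  · field_simp
    ring
  · exact (by fun_prop : Continuous _).intervalIntegrable _ _
  · refine Continuous.intervalIntegrable ?_ _ _
    fun_prop (disch := exact fun x => (hD (x - μ)).ne')

lemma integral_score_mean_mul_score_concentration {ρ : ℝ} (hρ : |ρ| < 1) (μ : ℝ) :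
    ∫ x in (0 : ℝ)..(2 * π),
      2 * ρ * sin (x - μ) / (1 + ρ ^ 2 - 2 * ρ * cos (x - μ)) *
        (2 * ((1 + ρ ^ 2) * cos (x - μ) - 2 * ρ) /
          ((1 - ρ ^ 2) * (1 + ρ ^ 2 - 2 * ρ * cos (x - μ)))) * wrappedCauchy μ ρ x = 0 := by
  have hρ2 : 1 - ρ ^ 2 ≠ 0 := (sub_pos.2 ((sq_lt_one_iff_abs_lt_one ρ).2 hρ)).ne'
  have hD := wrappedCauchy_denom_pos hρ
  let f (t : ℝ) : ℝ := 4 * ρ / (2 * π) *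
    (sin t * ((1 + ρ ^ 2) * cos t - 2 * ρ) / (1 + ρ ^ 2 - 2 * ρ * cos t) ^ 3)
  have h (x : ℝ) : 2 * ρ * sin (x - μ) / (1 + ρ ^ 2 - 2 * ρ * cos (x - μ)) *
        (2 * ((1 + ρ ^ 2) * cos (x - μ) - 2 * ρ) /
          ((1 - ρ ^ 2) * (1 + ρ ^ 2 - 2 * ρ * cos (x - μ)))) * wrappedCauchy μ ρ x =
      f (x - μ) := by
    have hDx := (hD (x - μ)).ne'
    simp only [wrappedCauchy, f]
    field_simp
    ring
  simp_rw [h]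
  have hodd : ∀ t, f (-t) = -f t := fun t => by
    simp only [f, sin_neg, cos_neg]
    ring
  have hper : Function.Periodic f (2 * π) := fun t => by
    simp only [f, sin_add_two_pi, cos_add_two_pi]
  have hshift : ∫ x in (0 : ℝ)..(2 * π), f (x - μ) = ∫ x in (-π)..π, f x := by
    rw [intervalIntegral.integral_comp_sub_right, show 2 * π - μ = 0 - μ + 2 * π by ring,
      hper.intervalIntegral_add_eq (0 - μ) (-π)]
    congr 1
    ring
  have hneg : ∫ x in (-π)..π, f (-x) = ∫ x in (-π)..π, f x := by
    simp
  simp_rw [hodd, intervalIntegral.integral_neg] at hneg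
  rw [hshift]
  linarith

/-- the Fisher information matrix of the wrapped Cauchy family with respect
to `(μ, ρ)` is diagonal, with entries `I_{μμ} = 2ρ²/(1−ρ²)²` and `I_{ρρ} = 2/(1−ρ²)²`. -/
theorem wrappedCauchy_fisher_information (ρ : ℝ) (hρ : ρ ∈ Set.Ioo (0:ℝ) 1)
    (μ : ℝ) (hμ : μ ∈ Set.Ico 0 (2 * π)) :
    (∫ x in (0:ℝ)..(2 * π),
        (deriv (fun m => Real.log (wrappedCauchy m ρ x)) μ) ^ 2 * wrappedCauchy μ ρ x) =
      2 * ρ ^ 2 / (1 - ρ ^ 2) ^ 2 ∧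
    (∫ x in (0:ℝ)..(2 * π),
        (deriv (fun r => Real.log (wrappedCauchy μ r x)) ρ) ^ 2 * wrappedCauchy μ ρ x) =
      2 / (1 - ρ ^ 2) ^ 2 ∧
    (∫ x in (0:ℝ)..(2 * π),
        (deriv (fun m => Real.log (wrappedCauchy m ρ x)) μ) *
          (deriv (fun r => Real.log (wrappedCauchy μ r x)) ρ) * wrappedCauchy μ ρ x) = 0 := by
  have hρ' : |ρ| < 1 := by
    rw [abs_of_pos hρ.1]
    exact hρ.2
  simp_rw [deriv_log_wrappedCauchy_mean hρ', deriv_log_wrappedCauchy_concentration hρ']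
  exact ⟨integral_score_mean_sq hρ' hρ.1.ne' μ, integral_score_concentration_sq hρ' hρ.1.ne' μ,
    integral_score_mean_mul_score_concentration hρ' μ⟩
end

section
/- For every μ ∈ [0, 2π), κ > 0, and λ ∈ (−1, 1), the Fisher information matrix of the sine-skewed von Mises family p(x | μ, κ, λ) = (1/(2π I_0(κ))) exp(κ cos(x − μ)) (1 + λ sin(x − μ)) with respect to (μ, κ, λ) satisfies I_{μκ} = (λ/2)(I_2(κ)/I_0(κ) − 1), I_{κκ} = 1/2 + I_2(κ)/(2 I_0(κ)) − (I_1(κ)/I_0(κ))², and I_{κλ} = 0. Explicitly, with expectation E taken under p(x | μ, κ, λ): E[(∂_μ log p)(∂_κ log p)] = (λ/2)(I_2(κ)/I_0(κ) − 1), E[(∂_κ log p)²] = 1/2 + I_2(κ)/(2 I_0(κ)) − (I_1(κ)/I_0(κ))², and E[(∂_κ log p)(∂_λ log p)] = 0. -/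
open MeasureTheory Real Filter
open scoped ENNReal

/-- The modified Bessel function of the first kind of integer order `n`:
`I_n(κ) = (1/(2π)) ∫_0^{2π} e^{κ cos t} cos(n t) dt`. -/
noncomputable def besselI (n : ℕ) (κ : ℝ) : ℝ :=
  (1 / (2 * π)) * ∫ t in (0:ℝ)..(2 * π), Real.exp (κ * Real.cos t) * Real.cos (n * t)

/-- The sine-skewed von Mises density on `[0, 2π)` with mean `μ`, concentration `κ` and
skewness `lam`. -/
noncomputable def sineSkewedVonMises (μ κ lam x : ℝ) : ℝ :=
  (1 / (2 * π * besselI 0 κ)) * Real.exp (κ * Real.cos (x - μ)) * (1 + lam * Real.sin (x - μ))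

open intervalIntegral in
/-- The integral of a periodic function over a period is invariant under translation. -/
lemma integral_comp_sub_period {f : ℝ → ℝ} {T : ℝ} (hf : Function.Periodic f T) (a : ℝ) :
    ∫ x in (0:ℝ)..T, f (x - a) = ∫ x in (0:ℝ)..T, f x := by
  rw [integral_comp_sub_right, show T - a = 0 - a + T by ring,
    hf.intervalIntegral_add_eq (0 - a) 0, zero_add]

/-- An odd periodic function has integral zero over a period. -/
lemma integral_period_eq_zero_of_odd {f : ℝ → ℝ} {T : ℝ} (hf : Function.Periodic f T)
    (hodd : Function.Odd f) : ∫ x in (0:ℝ)..T, f x = 0 := by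
  have h := intervalIntegral.integral_comp_sub_left (a := 0) (b := T) f T
  simp only [sub_self, sub_zero, fun x => (hf.sub_eq' (x := x)), hodd _,
    intervalIntegral.integral_neg] at h
  linarith

lemma integral_exp_mul_cos_eq_besselI (n : ℕ) (κ : ℝ) :
    ∫ t in (0:ℝ)..(2 * π), Real.exp (κ * Real.cos t) * Real.cos (n * t) =
      2 * π * besselI n κ := by
  unfold besselI
  field_simp

lemma besselI_zero_pos (κ : ℝ) : 0 < besselI 0 κ := by
  unfold besselI
  refine mul_pos (by positivity) ?_
  refine intervalIntegral.intervalIntegral_pos_of_pos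
    (Continuous.intervalIntegrable (by fun_prop) _ _) (fun t => ?_) (by positivity)
  simp [Real.exp_pos]

lemma hasDerivAt_besselI_zero (κ : ℝ) : HasDerivAt (besselI 0) (besselI 1 κ) κ := by
  have h := (intervalIntegral.hasDerivAt_integral_of_dominated_loc_of_deriv_le
    (μ := volume) (a := 0) (b := 2 * π) (x₀ := κ) (s := Metric.ball κ 1)
    (F := fun k t => Real.exp (k * Real.cos t) * Real.cos ((0 : ℕ) * t))
    (F' := fun k t => Real.exp (k * Real.cos t) * Real.cos ((1 : ℕ) * t))
    (bound := fun _ => Real.exp (|κ| + 1))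
    (Metric.ball_mem_nhds κ one_pos)
    (Eventually.of_forall fun k => Continuous.aestronglyMeasurable (by fun_prop))
    (Continuous.intervalIntegrable (by fun_prop) _ _)
    (Continuous.aestronglyMeasurable (by fun_prop))
    (Eventually.of_forall fun t _ k hk => ?_) intervalIntegrable_const
    (Eventually.of_forall fun t _ k _ => ?_)).2
  · exact h.const_mul (1 / (2 * π))
  · have hk' : |k| ≤ |κ| + 1 := by
      have h₁ := abs_sub_abs_le_abs_sub k κ
      rw [Metric.mem_ball, Real.dist_eq] at hk
      linarith
    have he : k * Real.cos t ≤ |κ| + 1 := by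
      refine ((le_abs_self _).trans_eq (abs_mul _ _)).trans ?_
      exact (mul_le_of_le_one_right (abs_nonneg k) (Real.abs_cos_le_one t)).trans hk'
    rw [Real.norm_eq_abs, abs_mul, Real.abs_exp]
    exact (mul_le_of_le_one_right (Real.exp_pos _).le (Real.abs_cos_le_one _)).trans
      (Real.exp_le_exp.2 he)
  · have h₁ := ((hasDerivAt_id k).mul_const (Real.cos t)).exp
    simpa using h₁

lemma one_add_mul_sin_pos {lam : ℝ} (hlam : lam ∈ Set.Ioo (-1:ℝ) 1) (y : ℝ) :
    0 < 1 + lam * Real.sin y := by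
  have h : |lam * Real.sin y| < 1 := by
    rw [abs_mul]
    exact (mul_le_of_le_one_right (abs_nonneg _) (Real.abs_sin_le_one y)).trans_lt
      (abs_lt.2 hlam)
  linarith [(abs_lt.1 h).1]

lemma log_sineSkewedVonMises (μ κ x : ℝ) {lam : ℝ} (hlam : lam ∈ Set.Ioo (-1:ℝ) 1) :
    Real.log (sineSkewedVonMises μ κ lam x) =
      κ * Real.cos (x - μ) - Real.log (besselI 0 κ) + Real.log (1 + lam * Real.sin (x - μ))
        - Real.log (2 * π) := by
  have h₀ := besselI_zero_pos κ
  have h₁ := one_add_mul_sin_pos hlam (x - μ)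
  unfold sineSkewedVonMises
  rw [Real.log_mul (by positivity) h₁.ne', Real.log_mul (by positivity) (Real.exp_pos _).ne',
    Real.log_exp, one_div, Real.log_inv, Real.log_mul (by positivity) h₀.ne']
  ring

lemma deriv_log_sineSkewedVonMises_mean (μ κ x : ℝ) {lam : ℝ} (hlam : lam ∈ Set.Ioo (-1:ℝ) 1) :
    deriv (fun m => Real.log (sineSkewedVonMises m κ lam x)) μ =
      κ * Real.sin (x - μ) - lam * Real.cos (x - μ) / (1 + lam * Real.sin (x - μ)) := by
  simp only [log_sineSkewedVonMises _ _ _ hlam]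
  have h := (hasDerivAt_id μ).const_sub x
  have hs := ((h.sin.const_mul lam).const_add 1).log (one_add_mul_sin_pos hlam (x - μ)).ne'
  refine (HasDerivAt.congr_deriv ((((h.cos.const_mul κ).sub_const
    (Real.log (besselI 0 κ))).add hs).sub_const (Real.log (2 * π))) ?_).deriv
  simp only [id]
  ring

lemma deriv_log_sineSkewedVonMises_concentration (μ κ x : ℝ) {lam : ℝ}
    (hlam : lam ∈ Set.Ioo (-1:ℝ) 1) :
    deriv (fun k => Real.log (sineSkewedVonMises μ k lam x)) κ =
      Real.cos (x - μ) - besselI 1 κ / besselI 0 κ := by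
  simp only [log_sineSkewedVonMises _ _ _ hlam]
  have hI := (hasDerivAt_besselI_zero κ).log (besselI_zero_pos κ).ne'
  refine (HasDerivAt.congr_deriv (((((hasDerivAt_id κ).mul_const (Real.cos (x - μ))).sub
    hI).add_const (Real.log (1 + lam * Real.sin (x - μ)))).sub_const (Real.log (2 * π))) ?_).deriv
  ring

lemma deriv_log_sineSkewedVonMises_skewness (μ κ x : ℝ) {lam : ℝ}
    (hlam : lam ∈ Set.Ioo (-1:ℝ) 1) :
    deriv (fun l => Real.log (sineSkewedVonMises μ κ l x)) lam =
      Real.sin (x - μ) / (1 + lam * Real.sin (x - μ)) := by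
  have heq : (fun l => Real.log (sineSkewedVonMises μ κ l x)) =ᶠ[nhds lam] fun l =>
      κ * Real.cos (x - μ) - Real.log (besselI 0 κ) + Real.log (1 + l * Real.sin (x - μ))
        - Real.log (2 * π) := by
    filter_upwards [isOpen_Ioo.mem_nhds hlam] with l hl
    exact log_sineSkewedVonMises μ κ x hl
  rw [heq.deriv_eq]
  have hs := (((hasDerivAt_id lam).mul_const (Real.sin (x - μ))).const_add 1).log
    (one_add_mul_sin_pos hlam (x - μ)).ne'
  refine (HasDerivAt.congr_deriv ((hs.const_add (κ * Real.cos (x - μ) -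
    Real.log (besselI 0 κ))).sub_const (Real.log (2 * π))) ?_).deriv
  simp only [id, one_mul]

/-- Integration by parts: `∫ e^{κ cos} (κ sin² (cos - A) - cos (cos - A) + sin²) = 0`. -/
lemma integral_exp_mul_cos_by_parts (κ A : ℝ) :
    ∫ t in (0:ℝ)..(2 * π), Real.exp (κ * Real.cos t) *
      (κ * Real.sin t ^ 2 * (Real.cos t - A) - Real.cos t * (Real.cos t - A) + Real.sin t ^ 2)
        = 0 := by
  rw [intervalIntegral.integral_eq_sub_of_hasDerivAt
    (f := fun t => -(Real.exp (κ * Real.cos t) * (Real.sin t * (Real.cos t - A))))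
    (fun t _ => ?_) (Continuous.intervalIntegrable (by fun_prop) _ _)]
  · simp only [Real.sin_two_pi, Real.sin_zero, zero_mul, mul_zero, neg_zero, sub_zero]
  · have h := ((((Real.hasDerivAt_cos t).const_mul κ).exp).mul
      ((Real.hasDerivAt_sin t).mul ((Real.hasDerivAt_cos t).sub_const A))).neg
    refine h.congr_deriv ?_
    simp only [Pi.mul_apply]
    ring

/-- Odd terms `e^{κ cos} sin · g(cos)` integrate to zero over a period. -/
lemma integral_sin_mul_comp_cos (g : ℝ → ℝ) :
    ∫ t in (0:ℝ)..(2 * π), Real.sin t * g (Real.cos t) = 0 :=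
  integral_period_eq_zero_of_odd (fun t => by simp) (fun t => by simp)

/-- The integral over a period of `e^{κ cos t} (a + b cos t + d cos 2t) + sin t · g(cos t)`. -/
lemma integral_exp_mul_cos_combination (κ a b d : ℝ) {g : ℝ → ℝ} (hg : Continuous g) :
    ∫ t in (0:ℝ)..(2 * π), (Real.exp (κ * Real.cos t) *
        (a + b * Real.cos t + d * Real.cos (2 * t)) + Real.sin t * g (Real.cos t)) =
      2 * π * (a * besselI 0 κ + b * besselI 1 κ + d * besselI 2 κ) := by
  have hi (n : ℕ) : IntervalIntegrable
      (fun t => Real.exp (κ * Real.cos t) * Real.cos (n * t)) volume 0 (2 * π) :=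
    Continuous.intervalIntegrable (by fun_prop) _ _
  have hs : IntervalIntegrable (fun t => Real.sin t * g (Real.cos t)) volume 0 (2 * π) :=
    Continuous.intervalIntegrable (by fun_prop) _ _
  calc _ = ∫ t in (0:ℝ)..(2 * π),
        (a * (Real.exp (κ * Real.cos t) * Real.cos ((0 : ℕ) * t)) +
          b * (Real.exp (κ * Real.cos t) * Real.cos ((1 : ℕ) * t)) +
          d * (Real.exp (κ * Real.cos t) * Real.cos ((2 : ℕ) * t)) +
          Real.sin t * g (Real.cos t)) := by
        congr 1 with t
        simp only [Nat.cast_zero, Nat.cast_one, Nat.cast_ofNat, zero_mul, one_mul, Real.cos_zero]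
        ring
    _ = _ := by
        rw [intervalIntegral.integral_add
            ((((hi 0).const_mul a).add ((hi 1).const_mul b)).add ((hi 2).const_mul d)) hs,
          intervalIntegral.integral_add
            (((hi 0).const_mul a).add ((hi 1).const_mul b)) ((hi 2).const_mul d),
          intervalIntegral.integral_add ((hi 0).const_mul a) ((hi 1).const_mul b)]
        simp only [intervalIntegral.integral_const_mul, integral_exp_mul_cos_eq_besselI,
          integral_sin_mul_comp_cos]
        ring

/-- for the sine-skewed von Mises family, the Fisher information entries
involving `κ` are `I_{μκ} = (λ/2)(I₂(κ)/I₀(κ) − 1)`,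
`I_{κκ} = 1/2 + I₂(κ)/(2I₀(κ)) − (I₁(κ)/I₀(κ))²`, and `I_{κλ} = 0`, where the scores are
the partial derivatives of `log p` and the expectation is taken under the density. -/
theorem sineSkewedVonMises_fisher_information (μ : ℝ) (hμ : μ ∈ Set.Ico 0 (2 * π))
    (κ : ℝ) (hκ : 0 < κ) (lam : ℝ) (hlam : lam ∈ Set.Ioo (-1:ℝ) 1) :
    (∫ x in (0:ℝ)..(2 * π),
        (deriv (fun m => Real.log (sineSkewedVonMises m κ lam x)) μ) *
          (deriv (fun k => Real.log (sineSkewedVonMises μ k lam x)) κ) *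
          sineSkewedVonMises μ κ lam x) =
      (lam / 2) * (besselI 2 κ / besselI 0 κ - 1) ∧
    (∫ x in (0:ℝ)..(2 * π),
        (deriv (fun k => Real.log (sineSkewedVonMises μ k lam x)) κ) ^ 2 *
          sineSkewedVonMises μ κ lam x) =
      1 / 2 + besselI 2 κ / (2 * besselI 0 κ) - (besselI 1 κ / besselI 0 κ) ^ 2 ∧
    (∫ x in (0:ℝ)..(2 * π),
        (deriv (fun k => Real.log (sineSkewedVonMises μ k lam x)) κ) *
          (deriv (fun l => Real.log (sineSkewedVonMises μ κ l x)) lam) *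
          sineSkewedVonMises μ κ lam x) = 0 := by
  have h₀ := besselI_zero_pos κ
  have hpos := one_add_mul_sin_pos hlam
  simp only [deriv_log_sineSkewedVonMises_mean _ _ _ hlam,
    deriv_log_sineSkewedVonMises_concentration _ _ _ hlam,
    deriv_log_sineSkewedVonMises_skewness _ _ _ hlam]
  simp only [sineSkewedVonMises]
  set A := besselI 1 κ / besselI 0 κ with hA
  set c := 1 / (2 * π * besselI 0 κ) with hc
  have hshift {f : ℝ → ℝ} (hf : Function.Periodic f (2 * π)) :=
    integral_comp_sub_period hf μ
  refine ⟨?_, ?_, ?_⟩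
  · rw [hshift (f := fun t => (κ * Real.sin t - lam * Real.cos t / (1 + lam * Real.sin t)) *
      (Real.cos t - A) * (c * Real.exp (κ * Real.cos t) * (1 + lam * Real.sin t)))
      (fun t => by simp)]
    calc _ = ∫ t in (0:ℝ)..(2 * π), (c * lam * (Real.exp (κ * Real.cos t) *
            (κ * Real.sin t ^ 2 * (Real.cos t - A) - Real.cos t * (Real.cos t - A)
              + Real.sin t ^ 2)) +
          (Real.exp (κ * Real.cos t) *
            (-(c * lam / 2) + 0 * Real.cos t + c * lam / 2 * Real.cos (2 * t)) +
          Real.sin t * (c * κ * Real.exp (κ * Real.cos t) * (Real.cos t - A)))) := by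
          congr 1 with t
          rw [Real.cos_two_mul]
          linear_combination (-((Real.cos t - A) * c * Real.exp (κ * Real.cos t))) *
              div_mul_cancel₀ (lam * Real.cos t) (hpos t).ne' -
            c * lam * Real.exp (κ * Real.cos t) * Real.sin_sq_add_cos_sq t
      _ = _ := by
          rw [intervalIntegral.integral_add (Continuous.intervalIntegrable (by fun_prop) _ _)
              (Continuous.intervalIntegrable (by fun_prop) _ _),
            intervalIntegral.integral_const_mul, integral_exp_mul_cos_by_parts,
            integral_exp_mul_cos_combination κ _ _ _
              (g := fun y => c * κ * Real.exp (κ * y) * (y - A)) (by fun_prop), hc]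
          field_simp
          ring
  · rw [hshift (f := fun t => (Real.cos t - A) ^ 2 *
      (c * Real.exp (κ * Real.cos t) * (1 + lam * Real.sin t))) (fun t => by simp)]
    calc _ = ∫ t in (0:ℝ)..(2 * π), (Real.exp (κ * Real.cos t) *
            (c * (1 / 2 + A ^ 2) + -(2 * c * A) * Real.cos t + c / 2 * Real.cos (2 * t)) +
          Real.sin t * (c * lam * Real.exp (κ * Real.cos t) * (Real.cos t - A) ^ 2)) := by
          congr 1 with t
          rw [Real.cos_two_mul]
          ring
      _ = _ := by
          rw [integral_exp_mul_cos_combination κ _ _ _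
              (g := fun y => c * lam * Real.exp (κ * y) * (y - A) ^ 2) (by fun_prop), hc, hA]
          field_simp
          ring
  · rw [hshift (f := fun t => (Real.cos t - A) * (Real.sin t / (1 + lam * Real.sin t)) *
      (c * Real.exp (κ * Real.cos t) * (1 + lam * Real.sin t))) (fun t => by simp)]
    refine Eq.trans ?_ (integral_sin_mul_comp_cos fun y => c * Real.exp (κ * y) * (y - A))
    congr 1 with t
    linear_combination ((Real.cos t - A) * c * Real.exp (κ * Real.cos t)) *
      div_mul_cancel₀ (Real.sin t) (hpos t).ne'
end
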